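/- arXiv:0903.3295 — 6 statements merged into one kernel-verified Lean document; each statement's English description precedes it below -/
import Mathlib

section
/- Let A = ⊕_{n≥0} A_n be a positively graded finite-dimensional k-algebra with c ≥ 1. Then there is an equivalence of categories A-gr ≃ t(A)-gr, where t(A) = b(A) ⋉ x(A). Explicitly, the functor Φ sending a graded A-module M = ⊕_{n∈ℤ} M_n to the graded t(A)-module Φ(M) with Φ(M)_n = ⊕_{i=nc}^{(n+1)c−1} M_i (with t(A) acting by the multiplication rule of matrices on column vectors) is an equivalence. -/
/-!
STATEMENT 4: Let `A = ⊕_{n≥0} A_n` be a positively graded finite-dimensional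
`k`-algebra with `c ≥ 1`.  Then there is an equivalence of categories
`A-gr ≃ t(A)-gr`, where `t(A) = b(A) ⋉ x(A)` (graded with `b(A)` in degree `0` and
`x(A)` in degree `1`).  Explicitly, there is such an equivalence `F` which compresses
the grading: `F M` has the same underlying space as `M`, with degree-`n` component
`⊕_{i=nc}^{(n+1)c-1} M_i`.
-/

open CategoryTheory MulOpposite
set_option synthInstance.maxHeartbeats 1000000
set_option maxHeartbeats 1000000
set_option linter.unusedVariables false

/-- The category of finite-dimensional `ℤ`-graded left modules (with degree-preserving
morphisms) over an algebra `A` graded by `𝒜 : ℕ → Submodule k A`. -/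
structure GrMod (k : Type) [Field k] (A : Type) [Ring A] [Algebra k A]
    (𝒜 : ℕ → Submodule k A) : Type 1 where
  carrier : Type
  [acg : AddCommGroup carrier]
  [modA : Module A carrier]
  [modk : Module k carrier]
  [tower : IsScalarTower k A carrier]
  [fd : FiniteDimensional k carrier]
  grading : ℤ → Submodule k carrier
  internal : DirectSum.IsInternal grading
  smul_mem : ∀ (i : ℕ) (j : ℤ) (a : A) (m : carrier),
    a ∈ 𝒜 i → m ∈ grading j → a • m ∈ grading (i + j)

attribute [instance] GrMod.acg GrMod.modA GrMod.modk GrMod.tower GrMod.fd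

instance GrMod.instCategory {k : Type} [Field k] {A : Type} [Ring A] [Algebra k A]
    {𝒜 : ℕ → Submodule k A} : CategoryTheory.Category (GrMod k A 𝒜) where
  Hom M N := {f : M.carrier →ₗ[A] N.carrier // ∀ (j : ℤ), ∀ m ∈ M.grading j, f m ∈ N.grading j}
  id M := ⟨LinearMap.id, fun _ _ hm => hm⟩
  comp f g := ⟨g.1.comp f.1, fun j m hm => g.2 j _ (f.2 j m hm)⟩

section WG
variable (k : Type) [Field k] (A : Type) [Ring A] [Algebra k A]

/-- `c` is an upper bound for the grading: all components above `c` vanish. -/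
class TopBounded (𝒜 : ℕ → Submodule k A) (c : ℕ) : Prop where
  eq_bot : ∀ n, c < n → 𝒜 n = ⊥

variable (𝒜 : ℕ → Submodule k A) [GradedAlgebra 𝒜] (c : ℕ)

def bei : Subalgebra k (Matrix (Fin c) (Fin c) A) where
  carrier := {M | ∀ i j : Fin c,
    ((i : ℕ) ≤ (j : ℕ) → M i j ∈ 𝒜 ((j : ℕ) - (i : ℕ))) ∧ ((j : ℕ) < (i : ℕ) → M i j = 0)}
  zero_mem' := fun i j => ⟨fun _ => by simp, fun _ => rfl⟩
  add_mem' := by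
    intro M N hM hN i j
    refine ⟨fun hij => Submodule.add_mem _ ((hM i j).1 hij) ((hN i j).1 hij), fun hij => ?_⟩
    show M i j + N i j = 0
    rw [(hM i j).2 hij, (hN i j).2 hij, add_zero]
  one_mem' := by
    intro i j
    constructor
    · intro hij
      by_cases h : i = j
      · subst h
        simpa [Matrix.one_apply] using SetLike.one_mem_graded 𝒜
      · simp [Matrix.one_apply, h]
    · intro hij
      have : i ≠ j := by intro h; subst h; exact lt_irrefl _ hij
      simp [Matrix.one_apply, this]
  mul_mem' := by
    intro M N hM hN i j
    constructor
    · intro hij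
      show (∑ l, M i l * N l j) ∈ 𝒜 ((j : ℕ) - (i : ℕ))
      refine Submodule.sum_mem _ (fun l _ => ?_)
      by_cases hil : (i : ℕ) ≤ (l : ℕ)
      · by_cases hlj : (l : ℕ) ≤ (j : ℕ)
        · have := SetLike.mul_mem_graded ((hM i l).1 hil) ((hN l j).1 hlj)
          have harith : (l : ℕ) - (i : ℕ) + ((j : ℕ) - (l : ℕ)) = (j : ℕ) - (i : ℕ) := by omega
          rwa [harith] at this
        · rw [(hN l j).2 (by omega), mul_zero]; exact Submodule.zero_mem _
      · rw [(hM i l).2 (by omega), zero_mul]; exact Submodule.zero_mem _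
    · intro hij
      show (∑ l, M i l * N l j) = 0
      refine Finset.sum_eq_zero (fun l _ => ?_)
      by_cases hil : (l : ℕ) < (i : ℕ)
      · rw [(hM i l).2 hil, zero_mul]
      · rw [(hN l j).2 (by omega), mul_zero]
  algebraMap_mem' := by
    intro r i j
    constructor
    · intro hij
      rw [Matrix.algebraMap_matrix_apply]
      by_cases h : i = j
      · subst h
        simpa using SetLike.algebraMap_mem_graded 𝒜 r
      · simp only [h, if_false]
        exact Submodule.zero_mem _
    · intro hij
      have h : i ≠ j := by intro h; subst h; exact lt_irrefl _ hij
      rw [Matrix.algebraMap_matrix_apply, if_neg h]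

def xA : Submodule k (Matrix (Fin c) (Fin c) A) where
  carrier := {M | ∀ i j : Fin c,
    ((j : ℕ) ≤ (i : ℕ) → M i j ∈ 𝒜 (c - ((i : ℕ) - (j : ℕ)))) ∧ ((i : ℕ) < (j : ℕ) → M i j = 0)}
  zero_mem' := fun i j => ⟨fun _ => by simp, fun _ => rfl⟩
  add_mem' := by
    intro M N hM hN i j
    refine ⟨fun hij => Submodule.add_mem _ ((hM i j).1 hij) ((hN i j).1 hij), fun hij => ?_⟩
    show M i j + N i j = 0
    rw [(hM i j).2 hij, (hN i j).2 hij, add_zero]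
  smul_mem' := by
    intro r M hM i j
    refine ⟨fun hij => Submodule.smul_mem _ r ((hM i j).1 hij), fun hij => ?_⟩
    show r • M i j = 0
    rw [(hM i j).2 hij, smul_zero]

variable [TopBounded k A 𝒜 c]

theorem bei_mul_xA_mem {M N : Matrix (Fin c) (Fin c) A}
    (hM : M ∈ bei k A 𝒜 c) (hN : N ∈ xA k A 𝒜 c) : M * N ∈ xA k A 𝒜 c := by
  intro i j
  constructor
  · intro hij
    show (∑ l, M i l * N l j) ∈ _
    refine Submodule.sum_mem _ (fun l _ => ?_)
    by_cases hil : (i : ℕ) ≤ (l : ℕ)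
    · by_cases hjl : (j : ℕ) ≤ (l : ℕ)
      · have := SetLike.mul_mem_graded ((hM i l).1 hil) ((hN l j).1 hjl)
        have harith : (l : ℕ) - (i : ℕ) + (c - ((l : ℕ) - (j : ℕ))) = c - ((i : ℕ) - (j : ℕ)) := by
          have := l.isLt; omega
        rwa [harith] at this
      · rw [(hN l j).2 (by omega), mul_zero]; exact Submodule.zero_mem _
    · rw [(hM i l).2 (by omega), zero_mul]; exact Submodule.zero_mem _
  · intro hij
    show (∑ l, M i l * N l j) = 0
    refine Finset.sum_eq_zero (fun l _ => ?_)
    by_cases hil : (i : ℕ) ≤ (l : ℕ)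
    · by_cases hjl : (j : ℕ) ≤ (l : ℕ)
      · have := SetLike.mul_mem_graded ((hM i l).1 hil) ((hN l j).1 hjl)
        rw [TopBounded.eq_bot (𝒜 := 𝒜) (c := c) _ (by have := l.isLt; omega)] at this
        simpa using this
      · rw [(hN l j).2 (by omega), mul_zero]
    · rw [(hM i l).2 (by omega), zero_mul]

theorem xA_mul_bei_mem {M N : Matrix (Fin c) (Fin c) A}
    (hM : M ∈ xA k A 𝒜 c) (hN : N ∈ bei k A 𝒜 c) : M * N ∈ xA k A 𝒜 c := by
  intro i j
  constructor
  · intro hij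
    show (∑ l, M i l * N l j) ∈ _
    refine Submodule.sum_mem _ (fun l _ => ?_)
    by_cases hil : (l : ℕ) ≤ (i : ℕ)
    · by_cases hlj : (l : ℕ) ≤ (j : ℕ)
      · have := SetLike.mul_mem_graded ((hM i l).1 hil) ((hN l j).1 hlj)
        have harith : (c - ((i : ℕ) - (l : ℕ))) + ((j : ℕ) - (l : ℕ)) = c - ((i : ℕ) - (j : ℕ)) := by
          have := i.isLt; omega
        rwa [harith] at this
      · rw [(hN l j).2 (by omega), mul_zero]; exact Submodule.zero_mem _
    · rw [(hM i l).2 (by omega), zero_mul]; exact Submodule.zero_mem _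
  · intro hij
    show (∑ l, M i l * N l j) = 0
    refine Finset.sum_eq_zero (fun l _ => ?_)
    by_cases hil : (l : ℕ) ≤ (i : ℕ)
    · by_cases hlj : (l : ℕ) ≤ (j : ℕ)
      · have := SetLike.mul_mem_graded ((hM i l).1 hil) ((hN l j).1 hlj)
        rw [TopBounded.eq_bot (𝒜 := 𝒜) (c := c) _ (by have := i.isLt; omega)] at this
        simpa using this
      · rw [(hN l j).2 (by omega), mul_zero]
    · rw [(hM i l).2 (by omega), zero_mul]

noncomputable instance xAModuleLeft : Module (bei k A 𝒜 c) (xA k A 𝒜 c) where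
  smul b x := ⟨b.1 * x.1, bei_mul_xA_mem k A 𝒜 c b.2 x.2⟩
  one_smul x := Subtype.ext (one_mul _)
  mul_smul b b' x := Subtype.ext (mul_assoc _ _ _)
  smul_zero b := Subtype.ext (mul_zero _)
  smul_add b x y := Subtype.ext (mul_add _ _ _)
  add_smul b b' x := Subtype.ext (add_mul _ _ _)
  zero_smul x := Subtype.ext (zero_mul _)

noncomputable instance xAModuleRight : Module (bei k A 𝒜 c)ᵐᵒᵖ (xA k A 𝒜 c) where
  smul b x := ⟨x.1 * (unop b).1, xA_mul_bei_mem k A 𝒜 c x.2 (unop b).2⟩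
  one_smul x := Subtype.ext (mul_one _)
  mul_smul b b' x := Subtype.ext (mul_assoc _ _ _).symm
  smul_zero b := Subtype.ext (zero_mul _)
  smul_add b x y := Subtype.ext (add_mul _ _ _)
  add_smul b b' x := Subtype.ext (mul_add _ _ _)
  zero_smul x := Subtype.ext (mul_zero _)

instance : SMulCommClass (bei k A 𝒜 c) (bei k A 𝒜 c)ᵐᵒᵖ (xA k A 𝒜 c) where
  smul_comm b b' x := Subtype.ext (mul_assoc _ _ _).symm

instance : IsScalarTower k (bei k A 𝒜 c) (xA k A 𝒜 c) where
  smul_assoc r b x := Subtype.ext (by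
    show ((r • b).1 * x.1) = r • (b.1 * x.1)
    rw [Subalgebra.coe_smul, smul_mul_assoc])

instance : IsScalarTower k (bei k A 𝒜 c)ᵐᵒᵖ (xA k A 𝒜 c) where
  smul_assoc r b x := Subtype.ext (by
    show (x.1 * (unop (r • b)).1) = r • (x.1 * (unop b).1)
    rw [MulOpposite.unop_smul, Subalgebra.coe_smul, mul_smul_comm])

/-- The algebra `t(A) = b(A) ⋉ x(A)`. -/
noncomputable abbrev tA := TrivSqZeroExt (bei k A 𝒜 c) (xA k A 𝒜 c)

end WG

section Grading
variable (k : Type) [Field k] (B X : Type) [Ring B] [Algebra k B]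
  [AddCommGroup X] [Module B X] [Module Bᵐᵒᵖ X] [SMulCommClass B Bᵐᵒᵖ X]
  [Module k X] [IsScalarTower k B X] [IsScalarTower k Bᵐᵒᵖ X]

/-- The degree-`0` component of `B ⋉ X`, namely `B`. -/
def tszDegZero : Submodule k (TrivSqZeroExt B X) where
  carrier := {p | TrivSqZeroExt.snd p = 0}
  zero_mem' := rfl
  add_mem' := by
    intro p q hp hq
    show TrivSqZeroExt.snd (p + q) = 0
    rw [TrivSqZeroExt.snd_add, hp, hq, add_zero]
  smul_mem' := by
    intro r p hp
    show TrivSqZeroExt.snd (r • p) = 0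
    rw [TrivSqZeroExt.snd_smul, hp, smul_zero]

/-- The degree-`1` component of `B ⋉ X`, namely `X`. -/
def tszDegOne : Submodule k (TrivSqZeroExt B X) where
  carrier := {p | TrivSqZeroExt.fst p = 0}
  zero_mem' := rfl
  add_mem' := by
    intro p q hp hq
    show TrivSqZeroExt.fst (p + q) = 0
    rw [TrivSqZeroExt.fst_add, hp, hq, add_zero]
  smul_mem' := by
    intro r p hp
    show TrivSqZeroExt.fst (r • p) = 0
    rw [TrivSqZeroExt.fst_smul, hp, smul_zero]

/-- The grading of the trivial extension `B ⋉ X`: `B` in degree `0`, `X` in degree `1`,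
and `0` elsewhere. -/
def tszGrading : ℕ → Submodule k (TrivSqZeroExt B X)
  | 0 => tszDegZero k B X
  | 1 => tszDegOne k B X
  | _ + 2 => ⊥

end Grading

set_option linter.unusedSectionVars false

section Embedding
variable (k : Type) [Field k] (A : Type) [Ring A] [Algebra k A]
  (𝒜 : ℕ → Submodule k A) [GradedAlgebra 𝒜] (c : ℕ)

theorem decompose_apply_of_mem {a : A} {r : ℕ} (ha : a ∈ 𝒜 r) (s : ℕ) :
    (DirectSum.decompose 𝒜 a s : A) = if r = s then a else 0 := by
  split_ifs with h
  · subst h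
    exact DirectSum.decompose_of_mem_same 𝒜 ha
  · exact DirectSum.decompose_of_mem_ne 𝒜 ha h

/-- The component in `b(A)` of the embedding `A → t(A)`. -/
def embedBei (a : A) : bei k A 𝒜 c :=
  ⟨Matrix.of fun i j => if (i : ℕ) ≤ j then (DirectSum.decompose 𝒜 a ((j : ℕ) - i) : A) else 0,
    fun i j => ⟨fun h => by rw [Matrix.of_apply, if_pos h]; exact SetLike.coe_mem _,
      fun h => by rw [Matrix.of_apply, if_neg (by omega)]⟩⟩

/-- The component in `x(A)` of the embedding `A → t(A)`. -/
def embedX (a : A) : xA k A 𝒜 c :=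
  ⟨Matrix.of fun i j =>
      if (j : ℕ) ≤ i then (DirectSum.decompose 𝒜 a (c - ((i : ℕ) - j)) : A) else 0,
    fun i j => ⟨fun h => by rw [Matrix.of_apply, if_pos h]; exact SetLike.coe_mem _,
      fun h => by rw [Matrix.of_apply, if_neg (by omega)]⟩⟩

theorem embedBei_apply_of_mem {a : A} {r : ℕ} (ha : a ∈ 𝒜 r) (i j : Fin c) :
    (embedBei k A 𝒜 c a).1 i j = if (i : ℕ) + r = j then a else 0 := by
  simp only [embedBei, Matrix.of_apply, decompose_apply_of_mem k A 𝒜 ha]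
  split_ifs <;> first | rfl | omega

theorem embedX_apply_of_mem {a : A} {r : ℕ} (ha : a ∈ 𝒜 r) (i j : Fin c) :
    (embedX k A 𝒜 c a).1 i j = if (i : ℕ) + r = j + c ∧ (j : ℕ) ≤ i then a else 0 := by
  simp only [embedX, Matrix.of_apply, decompose_apply_of_mem k A 𝒜 ha]
  split_ifs <;> first | rfl | omega

theorem embedBei_add (a b : A) :
    embedBei k A 𝒜 c (a + b) = embedBei k A 𝒜 c a + embedBei k A 𝒜 c b := by
  refine Subtype.ext (Matrix.ext fun i j => ?_)
  simp only [embedBei, Matrix.of_apply, DirectSum.decompose_add, Subalgebra.coe_add,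
    Matrix.add_apply, DirectSum.add_apply, Submodule.coe_add]
  split_ifs <;> simp

theorem embedX_add (a b : A) :
    embedX k A 𝒜 c (a + b) = embedX k A 𝒜 c a + embedX k A 𝒜 c b := by
  refine Subtype.ext (Matrix.ext fun i j => ?_)
  simp only [embedX, Matrix.of_apply, DirectSum.decompose_add,
    Matrix.add_apply, DirectSum.add_apply, Submodule.coe_add]
  split_ifs <;> simp

theorem embedBei_mul_of_mem {a b : A} {r s : ℕ} (ha : a ∈ 𝒜 r) (hb : b ∈ 𝒜 s) :
    (embedBei k A 𝒜 c (a * b)).1 = (embedBei k A 𝒜 c a).1 * (embedBei k A 𝒜 c b).1 := by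
  ext i j
  rw [Matrix.mul_apply, embedBei_apply_of_mem k A 𝒜 c (SetLike.mul_mem_graded ha hb)]
  simp only [embedBei_apply_of_mem k A 𝒜 c ha, embedBei_apply_of_mem k A 𝒜 c hb]
  by_cases h : (i : ℕ) + r < c
  · rw [Finset.sum_eq_single (⟨i + r, h⟩ : Fin c)]
    · simp [add_assoc]
    · intro l _ hl
      rw [if_neg (fun h' => hl (Fin.ext h'.symm)), zero_mul]
    · simp
  · rw [if_neg (by omega), Finset.sum_eq_zero]
    intro l _
    rw [if_neg (by omega), zero_mul]

variable [TopBounded k A 𝒜 c]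

theorem eq_zero_of_mem_of_lt {a : A} {r : ℕ} (ha : a ∈ 𝒜 r) (h : c < r) : a = 0 := by
  rw [TopBounded.eq_bot (𝒜 := 𝒜) (c := c) r h] at ha
  simpa using ha

theorem embedX_mul_of_mem {a b : A} {r s : ℕ} (ha : a ∈ 𝒜 r) (hb : b ∈ 𝒜 s) :
    (embedX k A 𝒜 c (a * b)).1 =
      (embedBei k A 𝒜 c a).1 * (embedX k A 𝒜 c b).1 +
        (embedX k A 𝒜 c a).1 * (embedBei k A 𝒜 c b).1 := by
  have hab := SetLike.mul_mem_graded ha hb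
  have hr : c < r → a = 0 := eq_zero_of_mem_of_lt k A 𝒜 c ha
  have hrs : c < r + s → a * b = 0 := eq_zero_of_mem_of_lt k A 𝒜 c hab
  ext i j
  rw [Matrix.add_apply, Matrix.mul_apply, Matrix.mul_apply, embedX_apply_of_mem k A 𝒜 c hab]
  simp only [embedBei_apply_of_mem k A 𝒜 c ha, embedBei_apply_of_mem k A 𝒜 c hb,
    embedX_apply_of_mem k A 𝒜 c ha, embedX_apply_of_mem k A 𝒜 c hb]
  by_cases h : (i : ℕ) + r < c
  · rw [Finset.sum_eq_single (⟨i + r, h⟩ : Fin c), Finset.sum_eq_zero]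
    · simp only [if_true, add_zero, mul_ite, mul_zero]
      split_ifs <;> first | rfl | omega | exact hrs (by omega) | exact (hrs (by omega)).symm
    · intro l _
      rw [if_neg (by omega), zero_mul]
    · intro l _ hl
      rw [if_neg (fun h' => hl (Fin.ext h'.symm)), zero_mul]
    · simp
  · rw [Finset.sum_eq_zero, zero_add]
    · by_cases h' : c < r
      · simp [hr h']
      · obtain ⟨l₀, hl₀⟩ : ∃ l : Fin c, (l : ℕ) + c = i + r := ⟨⟨i + r - c, by omega⟩, by
          show (i : ℕ) + r - c + c = i + r
          omega⟩
        rw [Finset.sum_eq_single l₀]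
        · rw [if_pos (show (i : ℕ) + r = l₀ + c ∧ (l₀ : ℕ) ≤ i by omega)]
          simp only [mul_ite, mul_zero]
          split_ifs <;> first | rfl | omega | exact hrs (by omega) | exact (hrs (by omega)).symm
        · intro l _ hl
          rw [if_neg (fun h' => hl (Fin.ext (by omega))), zero_mul]
        · simp
    · intro l _
      rw [if_neg (by omega), zero_mul]

/-- The embedding `A → t(A)`, as an additive map. -/
def embedAddHom : A →+ tA k A 𝒜 c :=
  AddMonoidHom.mk' (fun a => (embedBei k A 𝒜 c a, embedX k A 𝒜 c a)) fun a b =>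
    TrivSqZeroExt.ext (embedBei_add k A 𝒜 c a b) (embedX_add k A 𝒜 c a b)

theorem embedAddHom_one (hc : 1 ≤ c) : embedAddHom k A 𝒜 c 1 = 1 := by
  have h1 := SetLike.one_mem_graded 𝒜
  refine TrivSqZeroExt.ext (Subtype.ext ?_) (Subtype.ext ?_)
  · ext i j
    refine (embedBei_apply_of_mem k A 𝒜 c h1 i j).trans ?_
    show _ = (1 : Matrix (Fin c) (Fin c) A) i j
    simp [Matrix.one_apply, Fin.ext_iff]
  · ext i j
    refine (embedX_apply_of_mem k A 𝒜 c h1 i j).trans ?_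
    rw [if_neg (by omega)]
    rfl

theorem embedAddHom_mul (a b : A) :
    embedAddHom k A 𝒜 c (a * b) = embedAddHom k A 𝒜 c a * embedAddHom k A 𝒜 c b := by
  induction a using DirectSum.Decomposition.inductionOn 𝒜 with
  | zero => simp only [zero_mul, map_zero]
  | add a a' h h' => simp only [add_mul, map_add, h, h']
  | @homogeneous r a =>
    induction b using DirectSum.Decomposition.inductionOn 𝒜 with
    | zero => simp only [mul_zero, map_zero]
    | add b b' h h' => simp only [mul_add, map_add, h, h']
    | @homogeneous s b =>
      exact TrivSqZeroExt.ext (Subtype.ext (embedBei_mul_of_mem k A 𝒜 c a.2 b.2))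
        (Subtype.ext (embedX_mul_of_mem k A 𝒜 c a.2 b.2))

/-- The embedding of rings `A → t(A)`. -/
def embed (hc : 1 ≤ c) : A →+* tA k A 𝒜 c where
  __ := embedAddHom k A 𝒜 c
  map_one' := embedAddHom_one k A 𝒜 c hc
  map_mul' := embedAddHom_mul k A 𝒜 c

theorem fst_embed (hc : 1 ≤ c) (a : A) :
    (embed k A 𝒜 c hc a).fst = embedBei k A 𝒜 c a := rfl

theorem snd_embed (hc : 1 ≤ c) (a : A) :
    (embed k A 𝒜 c hc a).snd = embedX k A 𝒜 c a := rfl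

/-- The diagonal matrix idempotents of `b(A)`, seen in `t(A)`. -/
def vertex (j : Fin c) : tA k A 𝒜 c :=
  TrivSqZeroExt.inl ⟨Matrix.single j j 1, fun p q => by
    have h1 := SetLike.one_mem_graded 𝒜
    simp only [Matrix.single_apply]
    split_ifs with h
    · obtain ⟨rfl, rfl⟩ := h
      exact ⟨fun _ => by simpa using h1, fun h => absurd h (lt_irrefl _)⟩
    · exact ⟨fun _ => Submodule.zero_mem _, fun _ => rfl⟩⟩

theorem fst_mul_vertex_apply (t : tA k A 𝒜 c) (j p q : Fin c) :
    (t * vertex k A 𝒜 c j).fst.1 p q = if q = j then t.fst.1 p q else 0 := by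
  show (t.fst.1 * Matrix.single j j 1 : Matrix (Fin c) (Fin c) A) p q = _
  split_ifs with h
  · subst h; simp
  · simp [h]

theorem snd_mul_vertex_apply (t : tA k A 𝒜 c) (j p q : Fin c) :
    (t * vertex k A 𝒜 c j).snd.1 p q = if q = j then t.snd.1 p q else 0 := by
  show (t.fst.1 * 0 + t.snd.1 * Matrix.single j j 1 : Matrix (Fin c) (Fin c) A) p q = _
  rw [mul_zero, zero_add]
  split_ifs with h
  · subst h; simp
  · simp [h]

theorem fst_vertex_mul_apply (t : tA k A 𝒜 c) (j p q : Fin c) :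
    (vertex k A 𝒜 c j * t).fst.1 p q = if p = j then t.fst.1 p q else 0 := by
  show (Matrix.single j j 1 * t.fst.1 : Matrix (Fin c) (Fin c) A) p q = _
  split_ifs with h
  · subst h; simp
  · simp [h]

theorem snd_vertex_mul_apply (t : tA k A 𝒜 c) (j p q : Fin c) :
    (vertex k A 𝒜 c j * t).snd.1 p q = if p = j then t.snd.1 p q else 0 := by
  show (Matrix.single j j 1 * t.snd.1 + 0 * t.fst.1 : Matrix (Fin c) (Fin c) A) p q = _
  rw [zero_mul, add_zero]
  split_ifs with h
  · subst h; simp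
  · simp [h]

theorem tA_ext {s t : tA k A 𝒜 c} (h : ∀ p q, s.fst.1 p q = t.fst.1 p q)
    (h' : ∀ p q, s.snd.1 p q = t.snd.1 p q) : s = t :=
  TrivSqZeroExt.ext (Subtype.ext (Matrix.ext h)) (Subtype.ext (Matrix.ext h'))

theorem vertex_mul_embed (hc : 1 ≤ c) {a : A} {r : ℕ} (ha : a ∈ 𝒜 r) {i j : Fin c}
    (h : (i : ℕ) + r = j ∨ (i : ℕ) + r = j + c) :
    vertex k A 𝒜 c i * embed k A 𝒜 c hc a = embed k A 𝒜 c hc a * vertex k A 𝒜 c j := by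
  refine tA_ext k A 𝒜 c (fun p q => ?_) fun p q => ?_
  · rw [fst_mul_vertex_apply, fst_vertex_mul_apply, fst_embed,
      embedBei_apply_of_mem k A 𝒜 c ha]
    simp only [Fin.ext_iff]
    split_ifs <;> first | rfl | omega
  · rw [snd_mul_vertex_apply, snd_vertex_mul_apply, snd_embed,
      embedX_apply_of_mem k A 𝒜 c ha]
    simp only [Fin.ext_iff]
    split_ifs <;> first | rfl | omega

theorem embed_mul_vertex_mem_zero (hc : 1 ≤ c) {a : A} {r : ℕ} (ha : a ∈ 𝒜 r) {j : Fin c}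
    (h : r ≤ j) :
    embed k A 𝒜 c hc a * vertex k A 𝒜 c j ∈
      tszGrading k (bei k A 𝒜 c) (xA k A 𝒜 c) 0 := by
  refine Subtype.ext (Matrix.ext fun p q => ?_)
  rw [snd_mul_vertex_apply, snd_embed, embedX_apply_of_mem k A 𝒜 c ha]
  simp only [Fin.ext_iff]
  split_ifs <;> first | rfl | omega

theorem embed_mul_vertex_mem_one (hc : 1 ≤ c) {a : A} {r : ℕ} (ha : a ∈ 𝒜 r) {j : Fin c}
    (h : j < r) :
    embed k A 𝒜 c hc a * vertex k A 𝒜 c j ∈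
      tszGrading k (bei k A 𝒜 c) (xA k A 𝒜 c) 1 := by
  refine Subtype.ext (Matrix.ext fun p q => ?_)
  rw [fst_mul_vertex_apply, fst_embed, embedBei_apply_of_mem k A 𝒜 c ha]
  simp only [Fin.ext_iff]
  split_ifs <;> first | rfl | omega

/-- The total matrix `b + x` of an element `(b, x)` of `t(A)`. -/
def total : tA k A 𝒜 c →+ Matrix (Fin c) (Fin c) A :=
  AddMonoidHom.mk' (fun t => t.fst.1 + t.snd.1) fun s t =>
    add_add_add_comm s.fst.1 t.fst.1 s.snd.1 t.snd.1

theorem total_apply (t : tA k A 𝒜 c) (i j : Fin c) :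
    total k A 𝒜 c t i j = t.fst.1 i j + t.snd.1 i j := rfl

theorem total_one : total k A 𝒜 c 1 = 1 :=
  add_zero (1 : Matrix (Fin c) (Fin c) A)

theorem total_smul (r : k) (t : tA k A 𝒜 c) : total k A 𝒜 c (r • t) = r • total k A 𝒜 c t :=
  (smul_add r t.fst.1 t.snd.1).symm

theorem xA_mul_xA {M N : Matrix (Fin c) (Fin c) A} (hM : M ∈ xA k A 𝒜 c)
    (hN : N ∈ xA k A 𝒜 c) : M * N = 0 := by
  ext i j
  rw [Matrix.mul_apply]
  refine Finset.sum_eq_zero fun l _ => ?_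
  by_cases hil : (l : ℕ) ≤ i
  · by_cases hlj : (j : ℕ) ≤ l
    · exact eq_zero_of_mem_of_lt k A 𝒜 c
        (SetLike.mul_mem_graded ((hM i l).1 hil) ((hN l j).1 hlj)) (by omega)
    · rw [(hN l j).2 (by omega), mul_zero]
  · rw [(hM i l).2 (by omega), zero_mul]

theorem total_mul (s t : tA k A 𝒜 c) :
    total k A 𝒜 c (s * t) = total k A 𝒜 c s * total k A 𝒜 c t := by
  show s.fst.1 * t.fst.1 + (s.fst.1 * t.snd.1 + s.snd.1 * t.fst.1) =
    (s.fst.1 + s.snd.1) * (t.fst.1 + t.snd.1)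
  rw [add_mul, mul_add, mul_add, xA_mul_xA k A 𝒜 c s.snd.2 t.snd.2]
  abel

theorem total_vertex (j : Fin c) : total k A 𝒜 c (vertex k A 𝒜 c j) = Matrix.single j j 1 :=
  add_zero (Matrix.single j j (1 : A))

/-- An entry of the `b(A)`-component, as an additive map. -/
def fstEntry (p q : Fin c) : tA k A 𝒜 c →+ A :=
  AddMonoidHom.mk' (fun t => t.fst.1 p q) fun _ _ => rfl

/-- An entry of the `x(A)`-component, as an additive map. -/
def sndEntry (p q : Fin c) : tA k A 𝒜 c →+ A :=
  AddMonoidHom.mk' (fun t => t.snd.1 p q) fun _ _ => rfl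

theorem sum_vertex : ∑ j, vertex k A 𝒜 c j = 1 := by
  refine tA_ext k A 𝒜 c (fun p q => ?_) fun p q => ?_
  · show fstEntry k A 𝒜 c p q _ = (1 : Matrix (Fin c) (Fin c) A) p q
    rw [map_sum]
    show ∑ j, Matrix.single j j (1 : A) p q = _
    simp [Matrix.single_apply, Matrix.one_apply, ite_and]
  · show sndEntry k A 𝒜 c p q _ = 0
    rw [map_sum]
    exact Finset.sum_eq_zero fun _ _ => rfl

theorem sum_total_embed (hc : 1 ≤ c) (a : A) (j : Fin c) :
    ∑ i, total k A 𝒜 c (embed k A 𝒜 c hc a) i j = a := by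
  induction a using DirectSum.Decomposition.inductionOn 𝒜 with
  | zero => simp
  | add a a' h h' =>
    simp only [map_add, Matrix.add_apply, Finset.sum_add_distrib, h, h']
  | @homogeneous r a =>
    simp only [total_apply, fst_embed, snd_embed, embedX_apply_of_mem k A 𝒜 c a.2,
      embedBei_apply_of_mem k A 𝒜 c a.2]
    by_cases hr : c < r
    · simp [eq_zero_of_mem_of_lt k A 𝒜 c a.2 hr]
    · obtain ⟨i, hi⟩ : ∃ i : Fin c, (i : ℕ) + r = j ∨ (i : ℕ) + r = j + c := by
        by_cases h : r ≤ j
        · exact ⟨⟨j - r, by omega⟩, Or.inl (Nat.sub_add_cancel h)⟩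
        · exact ⟨⟨j + c - r, by omega⟩, Or.inr (Nat.sub_add_cancel (by omega))⟩
      rw [Finset.sum_eq_single i]
      · split_ifs <;> first | omega | simp
      · intro l _ hl
        rw [Ne, Fin.ext_iff] at hl
        rw [if_neg (by omega), if_neg (by omega), add_zero]
      · simp

theorem embedBei_total_apply (t : tA k A 𝒜 c) (i p q : Fin c) :
    (embedBei k A 𝒜 c (total k A 𝒜 c t i q)).1 p q = if i = p then t.fst.1 p q else 0 := by
  rw [total_apply, embedBei_add]
  show (embedBei k A 𝒜 c (t.fst.1 i q)).1 p q + (embedBei k A 𝒜 c (t.snd.1 i q)).1 p q = _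
  have h0 : (embedBei k A 𝒜 c 0).1 p q = 0 := by simp [embedBei]
  have hx : (embedBei k A 𝒜 c (t.snd.1 i q)).1 p q = 0 := by
    by_cases h : (q : ℕ) ≤ i
    · rw [embedBei_apply_of_mem k A 𝒜 c ((t.snd.2 i q).1 h), if_neg (by omega)]
    · rw [(t.snd.2 i q).2 (by omega), h0]
  rw [hx, add_zero]
  by_cases h : (i : ℕ) ≤ q
  · rw [embedBei_apply_of_mem k A 𝒜 c ((t.fst.2 i q).1 h)]
    by_cases hip : i = p
    · subst hip
      rw [if_pos (by omega), if_pos rfl]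
    · rw [if_neg hip, if_neg]
      rw [Fin.ext_iff] at hip
      omega
  · rw [(t.fst.2 i q).2 (by omega), h0]
    split_ifs with hip
    · subst hip
      rw [(t.fst.2 i q).2 (by omega)]
    · rfl

theorem embedX_total_apply (t : tA k A 𝒜 c) (i p q : Fin c) :
    (embedX k A 𝒜 c (total k A 𝒜 c t i q)).1 p q = if i = p then t.snd.1 p q else 0 := by
  rw [total_apply, embedX_add]
  show (embedX k A 𝒜 c (t.fst.1 i q)).1 p q + (embedX k A 𝒜 c (t.snd.1 i q)).1 p q = _
  have h0 : (embedX k A 𝒜 c 0).1 p q = 0 := by simp [embedX]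
  have hx : (embedX k A 𝒜 c (t.fst.1 i q)).1 p q = 0 := by
    by_cases h : (i : ℕ) ≤ q
    · rw [embedX_apply_of_mem k A 𝒜 c ((t.fst.2 i q).1 h), if_neg (by omega)]
    · rw [(t.fst.2 i q).2 (by omega), h0]
  rw [hx, zero_add]
  by_cases h : (q : ℕ) ≤ i
  · rw [embedX_apply_of_mem k A 𝒜 c ((t.snd.2 i q).1 h)]
    by_cases hip : i = p
    · subst hip
      rw [if_pos (by omega), if_pos rfl]
    · rw [if_neg hip, if_neg]
      rw [Fin.ext_iff] at hip
      omega
  · rw [(t.snd.2 i q).2 (by omega), h0]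
    split_ifs with hip
    · subst hip
      rw [(t.snd.2 i q).2 (by omega)]
    · rfl

theorem eq_sum_embed_total_mul_vertex (hc : 1 ≤ c) (t : tA k A 𝒜 c) :
    t = ∑ i, ∑ j, embed k A 𝒜 c hc (total k A 𝒜 c t i j) * vertex k A 𝒜 c j := by
  refine tA_ext k A 𝒜 c (fun p q => ?_) fun p q => ?_
  · show _ = fstEntry k A 𝒜 c p q _
    simp only [map_sum]
    show _ = ∑ i, ∑ j, (embed k A 𝒜 c hc (total k A 𝒜 c t i j) * vertex k A 𝒜 c j).fst.1 p q
    simp only [fst_mul_vertex_apply, fst_embed]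
    simp [embedBei_total_apply]
  · show _ = sndEntry k A 𝒜 c p q _
    simp only [map_sum]
    show _ = ∑ i, ∑ j, (embed k A 𝒜 c hc (total k A 𝒜 c t i j) * vertex k A 𝒜 c j).snd.1 p q
    simp only [snd_mul_vertex_apply, snd_embed]
    simp [embedX_total_apply]

theorem embed_smul (hc : 1 ≤ c) (r : k) (a : A) :
    embed k A 𝒜 c hc (r • a) = r • embed k A 𝒜 c hc a := by
  refine tA_ext k A 𝒜 c (fun p q => ?_) fun p q => ?_
  · show (embedBei k A 𝒜 c (r • a)).1 p q = r • (embedBei k A 𝒜 c a).1 p q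
    simp only [embedBei, Matrix.of_apply, DirectSum.decompose_smul, DirectSum.smul_apply,
      Submodule.coe_smul, smul_ite, smul_zero]
  · show (embedX k A 𝒜 c (r • a)).1 p q = r • (embedX k A 𝒜 c a).1 p q
    simp only [embedX, Matrix.of_apply, DirectSum.decompose_smul, DirectSum.smul_apply,
      Submodule.coe_smul, smul_ite, smul_zero]

theorem vertex_mem_zero (j : Fin c) :
    vertex k A 𝒜 c j ∈ tszGrading k (bei k A 𝒜 c) (xA k A 𝒜 c) 0 :=
  rfl

theorem vertex_mul_vertex (i j : Fin c) :
    vertex k A 𝒜 c i * vertex k A 𝒜 c j = if i = j then vertex k A 𝒜 c j else 0 := by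
  refine tA_ext k A 𝒜 c (fun p q => ?_) fun p q => ?_
  · rw [fst_vertex_mul_apply]
    show (if p = i then Matrix.single j j (1 : A) p q else 0) = _
    split_ifs with hp h h
    · rfl
    · rw [Matrix.single_apply_of_ne]
      · rfl
      · exact fun h' => h (hp ▸ h'.1.symm)
    · refine Eq.symm (Matrix.single_apply_of_ne _ _ _ _ _ fun h' => hp ?_)
      rw [h, h'.1]
    · rfl
  · rw [snd_vertex_mul_apply]
    split_ifs <;> rfl

end Embedding

section InternalSum
variable {k : Type} [Field k] {V : Type} [AddCommGroup V] [Module k V]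

theorem DirectSum.IsInternal.exists_scaling {𝓜 : ℤ → Submodule k V}
    (h : DirectSum.IsInternal 𝓜) (χ : ℤ → k) :
    ∃ f : V →ₗ[k] V, ∀ d, ∀ m ∈ 𝓜 d, f m = χ d • m := by
  let e := LinearEquiv.ofBijective (DirectSum.coeLinearMap 𝓜) h
  refine ⟨(DirectSum.toModule k ℤ V fun d => χ d • (𝓜 d).subtype) ∘ₗ e.symm.toLinearMap,
    fun d m hm => ?_⟩
  have he : e.symm m = DirectSum.lof k ℤ (fun d => 𝓜 d) d ⟨m, hm⟩ := by
    rw [LinearEquiv.symm_apply_eq]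
    exact (DirectSum.coeLinearMap_lof 𝓜 d ⟨m, hm⟩).symm
  simp [he]

theorem isInternal_of_projections {𝓜 : ℤ → Submodule k V}
    (h : ∀ d, ∃ q : V →ₗ[k] V, (∀ m ∈ 𝓜 d, q m = m) ∧ ∀ d' ≠ d, ∀ m ∈ 𝓜 d', q m = 0)
    (htop : iSup 𝓜 = ⊤) : DirectSum.IsInternal 𝓜 := by
  refine (DirectSum.isInternal_submodule_iff_iSupIndep_and_iSup_eq_top 𝓜).2 ⟨fun d => ?_, htop⟩
  obtain ⟨q, hq, hq0⟩ := h d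
  rw [Submodule.disjoint_def]
  intro m hm hm'
  have hle : ⨆ (d') (_ : d' ≠ d), 𝓜 d' ≤ LinearMap.ker q := iSup₂_le fun d' hd' => hq0 d' hd'
  rw [← hq m hm]
  exact hle hm'

end InternalSum

section Residue

theorem exists_eq_mul_add {c : ℕ} (hc : 1 ≤ c) (d : ℤ) :
    ∃ (n : ℤ) (j : Fin c), d = n * c + (c - 1 - j) := by
  have h0 := Int.emod_nonneg d (b := c) (by omega)
  have h1 := Int.emod_lt_of_pos d (b := c) (by omega)
  have h2 := Int.emod_add_mul_ediv d c
  refine ⟨d / c, ⟨(c - 1 - d % c).toNat, by omega⟩, ?_⟩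
  have h3 : (((c - 1 - d % c).toNat : ℕ) : ℤ) = c - 1 - d % c := Int.toNat_of_nonneg (by omega)
  show d = d / c * c + (c - 1 - ((c - 1 - d % c).toNat : ℕ))
  rw [h3]
  linarith [mul_comm (c : ℤ) (d / c)]

theorem fin_eq_of_dvd_sub {c : ℕ} {i j : Fin c} (h : (c : ℤ) ∣ (i : ℤ) - j) : i = j := by
  have h' := Int.eq_zero_of_abs_lt_dvd h (by rw [abs_lt]; omega)
  exact Fin.ext (by omega)

theorem dvd_add_iff {c : ℕ} (n : ℤ) (i j : Fin c) :
    (c : ℤ) ∣ n * c + (c - 1 - j) + i + 1 ↔ i = j := by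
  have e : n * c + (c - 1 - j) + i + 1 = (n + 1) * c + ((i : ℤ) - j) := by ring
  rw [e, Int.dvd_add_right (Dvd.intro_left _ rfl)]
  exact ⟨fin_eq_of_dvd_sub, fun h => by simp [h]⟩

theorem mul_add_ediv {c : ℕ} (n : ℤ) (j : Fin c) : (n * c + (c - 1 - j)) / (c : ℤ) = n := by
  rw [Int.add_comm, Int.add_mul_ediv_right _ _ (by have := j.pos; omega),
    Int.ediv_eq_zero_of_lt (by omega) (by omega), zero_add]

theorem mul_add_mem_Icc {c : ℕ} (n : ℤ) (j : Fin c) :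
    n * c + (c - 1 - j) ∈ Finset.Icc (n * (c : ℤ)) ((n + 1) * (c : ℤ) - 1) := by
  rw [Finset.mem_Icc, add_mul]
  omega

theorem eq_of_mul_add_mem_Icc {c : ℕ} {n n' : ℤ} {j : Fin c}
    (h : n' * c + (c - 1 - j) ∈ Finset.Icc (n * (c : ℤ)) ((n + 1) * (c : ℤ) - 1)) : n' = n := by
  rw [Finset.mem_Icc] at h
  have hj : (j : ℤ) < c := by omega
  have h1 : n < n' + 1 := lt_of_mul_lt_mul_right (a := (c : ℤ)) (by linarith) (by omega)
  have h2 : n' < n + 1 := lt_of_mul_lt_mul_right (a := (c : ℤ)) (by linarith) (by omega)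
  omega

end Residue

section GrModBasics
variable {k : Type} [Field k] {A : Type} [Ring A] [Algebra k A] {𝒜 : ℕ → Submodule k A}

theorem GrMod.induction (M : GrMod k A 𝒜) {motive : M.carrier → Prop}
    (mem : ∀ d, ∀ m ∈ M.grading d, motive m) (add : ∀ m m', motive m → motive m' → motive (m + m'))
    (m : M.carrier) : motive m := by
  have hm : m ∈ iSup M.grading := by
    rw [M.internal.submodule_iSup_eq_top]
    trivial
  exact Submodule.iSup_induction M.grading (motive := motive) hm mem (mem 0 0 (Submodule.zero_mem _)) add

/-- The grading on `M` obtained by grouping together `c` consecutive degrees. -/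
def GrMod.blockGrading (M : GrMod k A 𝒜) (c : ℕ) (n : ℤ) : Submodule k M.carrier :=
  ⨆ i ∈ Finset.Icc (n * (c : ℤ)) ((n + 1) * (c : ℤ) - 1), M.grading i

theorem GrMod.blockGrading_le {M : GrMod k A 𝒜} {c : ℕ} (hc : 1 ≤ c) {n : ℤ}
    {S : Submodule k M.carrier} (h : ∀ j : Fin c, M.grading (n * c + (c - 1 - j)) ≤ S) :
    M.blockGrading c n ≤ S := by
  refine iSup₂_le fun i hi => ?_
  obtain ⟨n', j, rfl⟩ := exists_eq_mul_add hc i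
  obtain rfl := eq_of_mul_add_mem_Icc hi
  exact h j

theorem GrMod.le_blockGrading (M : GrMod k A 𝒜) {c : ℕ} (n : ℤ) (j : Fin c) :
    M.grading (n * c + (c - 1 - j)) ≤ M.blockGrading c n :=
  le_iSup₂_of_le _ (mul_add_mem_Icc n j) le_rfl

theorem GrMod.blockGrading_isInternal (M : GrMod k A 𝒜) {c : ℕ} (hc : 1 ≤ c) :
    DirectSum.IsInternal (M.blockGrading c) := by
  refine isInternal_of_projections (fun n => ?_) ?_
  · obtain ⟨q, hq⟩ := M.internal.exists_scaling (fun d => if d / (c : ℤ) = n then 1 else 0)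
    refine ⟨q, fun m hm => ?_, fun n' hn' m hm => ?_⟩
    · refine GrMod.blockGrading_le (S := LinearMap.eqLocus q LinearMap.id) hc (fun j x hx => ?_) hm
      rw [LinearMap.mem_eqLocus, hq _ x hx, mul_add_ediv]
      simp
    · refine GrMod.blockGrading_le (S := LinearMap.ker q) hc (fun j x hx => ?_) hm
      rw [LinearMap.mem_ker, hq _ x hx, mul_add_ediv]
      simp [hn']
  · rw [eq_top_iff, ← M.internal.submodule_iSup_eq_top]
    refine iSup_le fun d => ?_
    obtain ⟨n, j, rfl⟩ := exists_eq_mul_add hc d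
    exact le_iSup_of_le n (M.le_blockGrading n j)

/-- The projection of `M` onto the sum of its components in degrees congruent to `-j-1`. -/
noncomputable def GrMod.resProj (M : GrMod k A 𝒜) {c : ℕ} (j : Fin c) : Module.End k M.carrier :=
  (M.internal.exists_scaling (fun d => if (c : ℤ) ∣ d + j + 1 then 1 else 0)).choose

theorem GrMod.resProj_of_mem (M : GrMod k A 𝒜) {c : ℕ} (j : Fin c) {d : ℤ} {m : M.carrier}
    (hm : m ∈ M.grading d) : M.resProj j m = if (c : ℤ) ∣ d + j + 1 then m else 0 := by
  have h := (M.internal.exists_scaling (fun d => if (c : ℤ) ∣ d + j + 1 then 1 else 0)).choose_spec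
  rw [GrMod.resProj, h d m hm]
  split_ifs <;> simp

theorem GrMod.resProj_of_mem_mul_add (M : GrMod k A 𝒜) {c : ℕ} (i j : Fin c) {n : ℤ}
    {m : M.carrier} (hm : m ∈ M.grading (n * c + (c - 1 - j))) :
    M.resProj i m = if i = j then m else 0 := by
  simp only [M.resProj_of_mem i hm, dvd_add_iff]

theorem GrMod.sum_resProj (M : GrMod k A 𝒜) {c : ℕ} (hc : 1 ≤ c) (m : M.carrier) :
    ∑ j : Fin c, M.resProj j m = m := by
  induction m using M.induction with
  | add m m' h h' => simp only [map_add, Finset.sum_add_distrib, h, h']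
  | mem d m hm =>
    obtain ⟨n, j, rfl⟩ := exists_eq_mul_add hc d
    simp [M.resProj_of_mem_mul_add _ j hm]

theorem GrMod.resProj_mem {M : GrMod k A 𝒜} {c : ℕ} (hc : 1 ≤ c) (j : Fin c) {n : ℤ}
    {m : M.carrier} (hm : m ∈ M.blockGrading c n) :
    M.resProj j m ∈ M.grading (n * c + (c - 1 - j)) := by
  refine GrMod.blockGrading_le (S := (M.grading _).comap (M.resProj j)) hc (fun i x hx => ?_) hm
  rw [Submodule.mem_comap, M.resProj_of_mem_mul_add j i hx]
  split_ifs with h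
  · rwa [h]
  · exact Submodule.zero_mem _

theorem GrMod.hom_resProj {M N : GrMod k A 𝒜} (f : M ⟶ N) {c : ℕ} (j : Fin c) (m : M.carrier) :
    f.1 (M.resProj j m) = N.resProj j (f.1 m) := by
  induction m using M.induction with
  | add m m' h h' => simp only [map_add, h, h']
  | mem d m hm =>
    rw [M.resProj_of_mem j hm, N.resProj_of_mem j (f.2 d m hm)]
    split_ifs <;> simp

end GrModBasics

section Compress
variable {k : Type} [Field k] {A : Type} [Ring A] [Algebra k A]
  {𝒜 : ℕ → Submodule k A} [GradedAlgebra 𝒜] {c : ℕ} [TopBounded k A 𝒜 c]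

theorem GrMod.bei_smul_mem (M : GrMod k A 𝒜) (b : bei k A 𝒜 c) (i j : Fin c) {n : ℤ}
    {m : M.carrier} (hm : m ∈ M.grading (n * c + (c - 1 - j))) :
    b.1 i j • m ∈ M.grading (n * c + (c - 1 - i)) := by
  by_cases h : (i : ℕ) ≤ j
  · have := M.smul_mem _ _ _ _ ((b.2 i j).1 h) hm
    convert this using 2
    omega
  · rw [(b.2 i j).2 (by omega), zero_smul]
    exact Submodule.zero_mem _

theorem GrMod.xA_smul_mem (M : GrMod k A 𝒜) (x : xA k A 𝒜 c) (i j : Fin c) {n : ℤ}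
    {m : M.carrier} (hm : m ∈ M.grading (n * c + (c - 1 - j))) :
    x.1 i j • m ∈ M.grading ((n + 1) * c + (c - 1 - i)) := by
  by_cases h : (j : ℕ) ≤ i
  · have := M.smul_mem _ _ _ _ ((x.2 i j).1 h) hm
    convert this using 2
    rw [add_mul]
    omega
  · rw [(x.2 i j).2 (by omega), zero_smul]
    exact Submodule.zero_mem _

theorem GrMod.resProj_total_smul (M : GrMod k A 𝒜) (hc : 1 ≤ c) (t : tA k A 𝒜 c)
    (p i j : Fin c) (m : M.carrier) :
    M.resProj p (total k A 𝒜 c t i j • M.resProj j m) =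
      if p = i then total k A 𝒜 c t i j • M.resProj j m else 0 := by
  induction m using M.induction with
  | add m m' h h' =>
    simp only [map_add, smul_add, h, h']
    split_ifs <;> simp
  | mem d m hm =>
    obtain ⟨n, l, rfl⟩ := exists_eq_mul_add hc d
    rw [M.resProj_of_mem_mul_add j l hm]
    by_cases hjl : j = l
    · subst hjl
      rw [if_pos rfl, total_apply, add_smul, map_add,
        M.resProj_of_mem_mul_add p i (M.bei_smul_mem t.fst i j hm),
        M.resProj_of_mem_mul_add p i (M.xA_smul_mem t.snd i j hm)]
      split_ifs <;> simp
    · simp [hjl]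

/-- The action of an element of `t(A)` on `M`, by multiplication of matrices with columns. -/
noncomputable def GrMod.act (M : GrMod k A 𝒜) (t : tA k A 𝒜 c) : Module.End k M.carrier :=
  ∑ i, ∑ j, Algebra.lsmul k k M.carrier (total k A 𝒜 c t i j) * M.resProj j

theorem GrMod.act_apply (M : GrMod k A 𝒜) (t : tA k A 𝒜 c) (m : M.carrier) :
    M.act t m = ∑ i, ∑ j, total k A 𝒜 c t i j • M.resProj j m := by
  simp [GrMod.act, LinearMap.sum_apply]

theorem GrMod.act_of_mem (M : GrMod k A 𝒜) (t : tA k A 𝒜 c) {n : ℤ} {j : Fin c}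
    {m : M.carrier} (hm : m ∈ M.grading (n * c + (c - 1 - j))) :
    M.act t m = ∑ i, total k A 𝒜 c t i j • m := by
  rw [M.act_apply]
  refine Finset.sum_congr rfl fun i _ => ?_
  simp [M.resProj_of_mem_mul_add _ j hm]

/-- The ring homomorphism defining the `t(A)`-module structure on `M`. -/
noncomputable def GrMod.actHom (M : GrMod k A 𝒜) (hc : 1 ≤ c) :
    tA k A 𝒜 c →+* Module.End k M.carrier where
  toFun := M.act
  map_one' := by
    ext m
    rw [M.act_apply, total_one]
    simp [Matrix.one_apply, M.sum_resProj hc]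
  map_mul' s t := by
    ext m
    rw [Module.End.mul_apply, M.act_apply, M.act_apply s, M.act_apply t]
    simp only [map_sum, M.resProj_total_smul hc, total_mul, Matrix.mul_apply, Finset.sum_smul,
      mul_smul]
    refine Finset.sum_congr rfl fun i _ => ?_
    rw [Finset.sum_comm]
    refine Finset.sum_congr rfl fun l _ => ?_
    rw [Finset.sum_comm]
    simp [Finset.smul_sum]
  map_zero' := by
    ext m
    simp [M.act_apply]
  map_add' s t := by
    ext m
    simp [M.act_apply, add_smul, Finset.sum_add_distrib]

theorem GrMod.act_smul (M : GrMod k A 𝒜) (r : k) (t : tA k A 𝒜 c) (m : M.carrier) :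
    M.act (r • t) m = r • M.act t m := by
  simp only [M.act_apply, total_smul, Matrix.smul_apply, Finset.smul_sum, smul_assoc]

theorem GrMod.act_mem (M : GrMod k A 𝒜) (hc : 1 ≤ c) {i : ℕ} {n : ℤ} {t : tA k A 𝒜 c}
    {m : M.carrier} (ht : t ∈ tszGrading k (bei k A 𝒜 c) (xA k A 𝒜 c) i)
    (hm : m ∈ M.blockGrading c n) : M.act t m ∈ M.blockGrading c (i + n) := by
  refine GrMod.blockGrading_le (S := (M.blockGrading c (i + n)).comap (M.act t)) hc
    (fun j x hx => ?_) hm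
  rw [Submodule.mem_comap, M.act_of_mem t hx]
  refine Submodule.sum_mem _ fun l _ => ?_
  rw [total_apply]
  match i, ht with
  | 0, ht =>
    have h0 : t.snd = 0 := ht
    have hl := M.le_blockGrading _ l (M.bei_smul_mem t.fst l j hx)
    rw [h0]
    simpa using hl
  | 1, ht =>
    have h0 : t.fst = 0 := ht
    have hl := M.le_blockGrading _ l (M.xA_smul_mem t.snd l j hx)
    rw [h0, Nat.cast_one, add_comm (1 : ℤ) n]
    simpa using hl
  | i + 2, ht =>
    have h0 : t = 0 := ht
    subst h0
    simp

/-- The graded `t(A)`-module attached to a graded `A`-module. -/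
noncomputable abbrev GrMod.compress (M : GrMod k A 𝒜) (hc : 1 ≤ c) :
    GrMod k (tA k A 𝒜 c) (tszGrading k (bei k A 𝒜 c) (xA k A 𝒜 c)) where
  carrier := M.carrier
  modA := Module.compHom M.carrier (M.actHom hc)
  tower :=
    letI : Module (tA k A 𝒜 c) M.carrier := Module.compHom M.carrier (M.actHom hc)
    ⟨fun r t m => M.act_smul r t m⟩
  grading := M.blockGrading c
  internal := M.blockGrading_isInternal hc
  smul_mem i n t m ht hm := M.act_mem hc ht hm

theorem GrMod.act_vertex (M : GrMod k A 𝒜) (j : Fin c) (m : M.carrier) :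
    M.act (vertex k A 𝒜 c j) m = M.resProj j m := by
  simp [M.act_apply, total_vertex, Matrix.single_apply, ite_and]

theorem GrMod.act_embed (M : GrMod k A 𝒜) (hc : 1 ≤ c) (a : A) (m : M.carrier) :
    M.act (embed k A 𝒜 c hc a) m = a • m := by
  rw [M.act_apply, Finset.sum_comm]
  simp only [← Finset.sum_smul, sum_total_embed]
  rw [← Finset.smul_sum, M.sum_resProj hc]

theorem GrMod.hom_act {M N : GrMod k A 𝒜} (f : M ⟶ N) (t : tA k A 𝒜 c) (m : M.carrier) :
    f.1 (M.act t m) = N.act t (f.1 m) := by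
  simp only [GrMod.act_apply, map_sum, map_smul, GrMod.hom_resProj]

theorem GrMod.hom_map_smul {M N : GrMod k A 𝒜} (f : M ⟶ N) (r : k) (m : M.carrier) :
    f.1 (r • m) = r • f.1 m := by
  rw [← algebraMap_smul A r m, ← algebraMap_smul A r (f.1 m), map_smul]

/-- The underlying `k`-linear map of a morphism. -/
def GrMod.homLin {M N : GrMod k A 𝒜} (f : M ⟶ N) : M.carrier →ₗ[k] N.carrier where
  toFun := f.1
  map_add' := map_add f.1
  map_smul' := GrMod.hom_map_smul f

theorem GrMod.hom_mem_blockGrading {M N : GrMod k A 𝒜} (hc : 1 ≤ c) (f : M ⟶ N) {n : ℤ}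
    {m : M.carrier} (hm : m ∈ M.blockGrading c n) : f.1 m ∈ N.blockGrading c n :=
  GrMod.blockGrading_le (S := (N.blockGrading c n).comap (GrMod.homLin f)) hc
    (fun j x hx => N.le_blockGrading n j (f.2 _ x hx)) hm

variable (k A 𝒜 c) in
/-- The functor from graded `A`-modules to graded `t(A)`-modules. -/
noncomputable def compressFunctor (hc : 1 ≤ c) :
    GrMod k A 𝒜 ⥤ GrMod k (tA k A 𝒜 c) (tszGrading k (bei k A 𝒜 c) (xA k A 𝒜 c)) where
  obj M := M.compress hc
  map {M N} f :=
    ⟨{ toFun := f.1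
       map_add' := map_add f.1
       map_smul' := fun t m => GrMod.hom_act f t m },
      fun n m hm => GrMod.hom_mem_blockGrading hc f hm⟩

theorem GrMod.hom_compress_act {M N : GrMod k A 𝒜} (hc : 1 ≤ c)
    (g : M.compress hc ⟶ N.compress hc) (t : tA k A 𝒜 c) (m : M.carrier) :
    g.1 (M.act t m) = N.act t (g.1 m) :=
  g.1.map_smul t m

theorem GrMod.hom_compress_mem {M N : GrMod k A 𝒜} (hc : 1 ≤ c)
    (g : M.compress hc ⟶ N.compress hc) {d : ℤ} {m : M.carrier} (hm : m ∈ M.grading d) :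
    (g.1 m : N.carrier) ∈ N.grading d := by
  obtain ⟨n, j, rfl⟩ := exists_eq_mul_add hc d
  have hgm : (g.1 m : N.carrier) ∈ N.blockGrading c n := g.2 n m (M.le_blockGrading n j hm)
  have h := GrMod.hom_compress_act hc g (vertex k A 𝒜 c j) m
  rw [M.act_vertex, N.act_vertex, M.resProj_of_mem_mul_add j j hm, if_pos rfl] at h
  rw [h]
  exact GrMod.resProj_mem hc j hgm

theorem GrMod.hom_compress_smul {M N : GrMod k A 𝒜} (hc : 1 ≤ c)
    (g : M.compress hc ⟶ N.compress hc) (a : A) (m : M.carrier) :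
    (g.1 (a • m) : N.carrier) = a • (show N.carrier from g.1 m) := by
  have h := GrMod.hom_compress_act hc g (embed k A 𝒜 c hc a) m
  rwa [M.act_embed, N.act_embed] at h

theorem compressFunctor_faithful (hc : 1 ≤ c) : (compressFunctor k A 𝒜 c hc).Faithful where
  map_injective {M N f g} h :=
    Subtype.ext (LinearMap.ext fun m => LinearMap.congr_fun (congrArg Subtype.val h) m)

theorem compressFunctor_full (hc : 1 ≤ c) : (compressFunctor k A 𝒜 c hc).Full where
  map_surjective {M N} g :=
    ⟨⟨{ toFun := g.1
        map_add' := map_add g.1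
        map_smul' := GrMod.hom_compress_smul hc g },
      fun d m hm => GrMod.hom_compress_mem hc g hm⟩, rfl⟩

end Compress

section Expand
variable {k : Type} [Field k] {A : Type} [Ring A] [Algebra k A]
  {𝒜 : ℕ → Submodule k A} [GradedAlgebra 𝒜] {c : ℕ} [TopBounded k A 𝒜 c]
  (N : GrMod k (tA k A 𝒜 c) (tszGrading k (bei k A 𝒜 c) (xA k A 𝒜 c)))

/-- The refined grading on a graded `t(A)`-module, cut out by the diagonal idempotents. -/
def fineGrading (d : ℤ) : Submodule k N.carrier where
  carrier := {m | m ∈ N.grading (d / c) ∧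
    ∀ j : Fin c, (c : ℤ) ∣ d + j + 1 → vertex k A 𝒜 c j • m = m}
  zero_mem' := ⟨Submodule.zero_mem _, fun _ _ => smul_zero _⟩
  add_mem' := fun {m m'} h h' => ⟨Submodule.add_mem _ h.1 h'.1, fun j hj => by
    rw [smul_add, h.2 j hj, h'.2 j hj]⟩
  smul_mem' := fun r m h => ⟨Submodule.smul_mem _ r h.1, fun j hj => by
    rw [smul_comm, h.2 j hj]⟩

theorem mem_fineGrading_iff {n : ℤ} {j : Fin c} {m : N.carrier} :
    m ∈ fineGrading N (n * c + (c - 1 - j)) ↔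
      m ∈ N.grading n ∧ vertex k A 𝒜 c j • m = m := by
  show (m ∈ N.grading _ ∧ ∀ i : Fin c, _ → _) ↔ _
  simp only [mul_add_ediv, dvd_add_iff, forall_eq]

theorem vertex_smul_of_mem_fineGrading {n : ℤ} (i : Fin c) {j : Fin c} {m : N.carrier}
    (hm : m ∈ fineGrading N (n * c + (c - 1 - j))) :
    vertex k A 𝒜 c i • m = if i = j then m else 0 := by
  have h := ((mem_fineGrading_iff N).1 hm).2
  split_ifs with hij
  · rw [hij, h]
  · rw [← h, smul_smul, vertex_mul_vertex, if_neg hij, zero_smul]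

theorem vertex_smul_mem_grading (j : Fin c) {n : ℤ} {m : N.carrier} (hm : m ∈ N.grading n) :
    vertex k A 𝒜 c j • m ∈ N.grading n := by
  simpa using N.smul_mem 0 n _ m (vertex_mem_zero k A 𝒜 c j) hm

theorem vertex_smul_mem_fineGrading (j : Fin c) {n : ℤ} {m : N.carrier}
    (hm : m ∈ N.grading n) :
    vertex k A 𝒜 c j • m ∈ fineGrading N (n * c + (c - 1 - j)) := by
  rw [mem_fineGrading_iff]
  refine ⟨vertex_smul_mem_grading N j hm, ?_⟩
  rw [smul_smul, vertex_mul_vertex, if_pos rfl]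

theorem sum_vertex_smul (m : N.carrier) : ∑ j, vertex k A 𝒜 c j • m = m := by
  rw [← Finset.sum_smul, sum_vertex, one_smul]

theorem fineGrading_isInternal (hc : 1 ≤ c) : DirectSum.IsInternal (fineGrading N) := by
  refine isInternal_of_projections (fun d => ?_) ?_
  · obtain ⟨n, j, rfl⟩ := exists_eq_mul_add hc d
    obtain ⟨q, hq⟩ := N.internal.exists_scaling (fun d => if d = n then 1 else 0)
    refine ⟨Algebra.lsmul k k N.carrier (vertex k A 𝒜 c j) * q, fun m hm => ?_,
      fun d' hd' m hm => ?_⟩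
    · have h := (mem_fineGrading_iff N).1 hm
      rw [Module.End.mul_apply, hq n m h.1, if_pos rfl, one_smul]
      exact h.2
    · obtain ⟨n', j', rfl⟩ := exists_eq_mul_add hc d'
      rw [Module.End.mul_apply, hq n' m ((mem_fineGrading_iff N).1 hm).1]
      split_ifs with hn
      · subst hn
        rw [one_smul]
        refine (vertex_smul_of_mem_fineGrading N j hm).trans (if_neg ?_)
        rintro rfl
        exact hd' rfl
      · rw [zero_smul, map_zero]
  · rw [eq_top_iff, ← N.internal.submodule_iSup_eq_top]
    refine iSup_le fun n m hm => ?_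
    rw [← sum_vertex_smul N m]
    exact Submodule.sum_mem _ fun j _ =>
      Submodule.mem_iSup_of_mem _ (vertex_smul_mem_fineGrading N j hm)

theorem embed_smul_mem_fineGrading (hc : 1 ≤ c) {r : ℕ} {d : ℤ} {a : A} {m : N.carrier}
    (ha : a ∈ 𝒜 r) (hm : m ∈ fineGrading N d) :
    embed k A 𝒜 c hc a • m ∈ fineGrading N (r + d) := by
  obtain ⟨n, j, rfl⟩ := exists_eq_mul_add hc d
  have h := (mem_fineGrading_iff N).1 hm
  have hmul : embed k A 𝒜 c hc a • m = (embed k A 𝒜 c hc a * vertex k A 𝒜 c j) • m := by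
    rw [mul_smul, h.2]
  by_cases hr : c < r
  · rw [eq_zero_of_mem_of_lt k A 𝒜 c ha hr, map_zero, zero_smul]
    exact Submodule.zero_mem _
  by_cases hj : r ≤ j
  · obtain ⟨i, hi⟩ : ∃ i : Fin c, (i : ℕ) + r = j :=
      ⟨⟨j - r, by omega⟩, Nat.sub_add_cancel hj⟩
    have e : (r : ℤ) + (n * c + (c - 1 - j)) = n * c + (c - 1 - i) := by omega
    rw [e, mem_fineGrading_iff, hmul, smul_smul, ← mul_assoc,
      vertex_mul_embed k A 𝒜 c hc ha (Or.inl hi), mul_assoc, vertex_mul_vertex, if_pos rfl]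
    refine ⟨?_, rfl⟩
    simpa using N.smul_mem 0 n _ m (embed_mul_vertex_mem_zero k A 𝒜 c hc ha hj) h.1
  · obtain ⟨i, hi⟩ : ∃ i : Fin c, (i : ℕ) + r = j + c :=
      ⟨⟨j + c - r, by omega⟩, Nat.sub_add_cancel (by omega)⟩
    have e : (r : ℤ) + (n * c + (c - 1 - j)) = (1 + n) * c + (c - 1 - i) := by
      rw [add_mul]
      omega
    rw [e, mem_fineGrading_iff, hmul, smul_smul, ← mul_assoc,
      vertex_mul_embed k A 𝒜 c hc ha (Or.inr hi), mul_assoc, vertex_mul_vertex, if_pos rfl]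
    refine ⟨?_, rfl⟩
    simpa using N.smul_mem 1 n _ m
      (embed_mul_vertex_mem_one k A 𝒜 c hc ha (not_le.1 hj)) h.1

/-- The graded `A`-module attached to a graded `t(A)`-module. -/
noncomputable abbrev expand (hc : 1 ≤ c) : GrMod k A 𝒜 where
  carrier := N.carrier
  modA := Module.compHom N.carrier (embed k A 𝒜 c hc)
  tower :=
    letI : Module A N.carrier := Module.compHom N.carrier (embed k A 𝒜 c hc)
    ⟨fun r a m => by
      show embed k A 𝒜 c hc (r • a) • m = r • embed k A 𝒜 c hc a • m
      rw [embed_smul, smul_assoc]⟩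
  grading := fineGrading N
  internal := fineGrading_isInternal N hc
  smul_mem r d a m ha hm := embed_smul_mem_fineGrading N hc ha hm

theorem expand_resProj (hc : 1 ≤ c) (j : Fin c) (m : N.carrier) :
    (expand N hc).resProj j m = vertex k A 𝒜 c j • m := by
  refine (expand N hc).induction (motive := fun m => (expand N hc).resProj j m =
    vertex k A 𝒜 c j • (show N.carrier from m)) (fun d m hm => ?_) (fun m m' h h' => ?_) m
  · obtain ⟨n, l, rfl⟩ := exists_eq_mul_add hc d
    exact ((expand N hc).resProj_of_mem_mul_add j l hm).trans
      (vertex_smul_of_mem_fineGrading N j hm).symm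
  · rw [map_add, h, h']
    exact (smul_add _ _ _).symm

theorem expand_act (hc : 1 ≤ c) (t : tA k A 𝒜 c) (m : N.carrier) :
    (expand N hc).act t m = t • m := by
  rw [GrMod.act_apply]
  conv_rhs => rw [eq_sum_embed_total_mul_vertex k A 𝒜 c hc t]
  simp only [Finset.sum_smul, mul_smul]
  refine Finset.sum_congr rfl fun i _ => Finset.sum_congr rfl fun j _ => ?_
  exact congrArg (embed k A 𝒜 c hc (total k A 𝒜 c t i j) • ·) (expand_resProj N hc j m)

theorem expand_blockGrading (hc : 1 ≤ c) (n : ℤ) :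
    (expand N hc).blockGrading c n = N.grading n := by
  refine le_antisymm (GrMod.blockGrading_le hc fun j m hm => ((mem_fineGrading_iff N).1 hm).1)
    fun m hm => ?_
  rw [← sum_vertex_smul N m]
  exact Submodule.sum_mem _ fun j _ =>
    (expand N hc).le_blockGrading n j (vertex_smul_mem_fineGrading N j hm)

/-- Expanding and then compressing a graded `t(A)`-module gives it back. -/
noncomputable def compressExpandIso (hc : 1 ≤ c) : (expand N hc).compress hc ≅ N where
  hom := ⟨{ toFun := fun m => m
            map_add' := fun _ _ => rfl
            map_smul' := expand_act N hc }, fun n m hm => by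
    rw [← expand_blockGrading N hc n]
    exact hm⟩
  inv := ⟨{ toFun := fun m => m
            map_add' := fun _ _ => rfl
            map_smul' := fun t m => (expand_act N hc t m).symm }, fun n m hm => by
    rw [← expand_blockGrading N hc n] at hm
    exact hm⟩
  hom_inv_id := rfl
  inv_hom_id := rfl

theorem compressFunctor_isEquivalence (hc : 1 ≤ c) :
    (compressFunctor k A 𝒜 c hc).IsEquivalence where
  faithful := compressFunctor_faithful hc
  full := compressFunctor_full hc
  essSurj := ⟨fun N => ⟨expand N hc, ⟨compressExpandIso N hc⟩⟩⟩

end Expand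

theorem graded_modules_equiv_tA
    (k : Type) [Field k] (A : Type) [Ring A] [Algebra k A] [FiniteDimensional k A]
    (𝒜 : ℕ → Submodule k A) [GradedAlgebra 𝒜]
    (c : ℕ) (hc : 1 ≤ c) (hcne : 𝒜 c ≠ ⊥) [TopBounded k A 𝒜 c] :
    ∃ F : GrMod k A 𝒜 ⥤
        GrMod k (tA k A 𝒜 c) (tszGrading k ↥(bei k A 𝒜 c) ↥(xA k A 𝒜 c)),
      F.IsEquivalence ∧
      ∀ M : GrMod k A 𝒜, ∃ φ : (F.obj M).carrier ≃ₗ[k] M.carrier,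
        ∀ n : ℤ, Submodule.map (φ : (F.obj M).carrier →ₗ[k] M.carrier)
            ((F.obj M).grading n) =
          ⨆ i ∈ Finset.Icc (n * (c : ℤ)) ((n + 1) * (c : ℤ) - 1), M.grading i := by
  refine ⟨compressFunctor k A 𝒜 c hc, compressFunctor_isEquivalence hc, fun M =>
    ⟨LinearEquiv.refl k M.carrier, fun n => ?_⟩⟩
  exact Submodule.map_id _
end

section
/- Let A = ⊕_{n≥0} A_n be a positively graded finite-dimensional k-algebra with c ≥ 1 and let t(A) = b(A) ⋉ x(A). Then A is left well-graded if and only if t(A) is left well-graded (i.e., for every nonzero idempotent e of the 0-th component b(A) of t(A), e·x(A) ≠ 0). -/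
/-!
STATEMENT 5: Let `A = ⊕_{n≥0} A_n` be a positively graded finite-dimensional
`k`-algebra with `c ≥ 1` and `t(A) = b(A) ⋉ x(A)`.  Then `A` is left well-graded iff
`t(A)` is left well-graded, i.e. for every nonzero idempotent `e` of the degree-zero
component `b(A)` of `t(A)` one has `e · x(A) ≠ 0`.

Here `b(A)` and `x(A)` are realised as spaces of `c × c` matrices over `A`, and the
`b(A)`-action on `x(A)` is induced by matrix multiplication (this is literally the
multiplication of `t(A) = b(A) ⊕ x(A)`, since products of two elements of `x(A)`
vanish as all their entries lie in components of degree `> c`).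
-/

set_option maxHeartbeats 1000000

/-- `A` is left well-graded: `e · A_c ≠ 0` for every nonzero idempotent `e ∈ A_0`. -/
def LeftWellGraded {k A : Type} [Field k] [Ring A] [Algebra k A]
    (𝒜 : ℕ → Submodule k A) (c : ℕ) : Prop :=
  ∀ e : A, e ∈ 𝒜 0 → IsIdempotentElem e → e ≠ 0 → ∃ x ∈ 𝒜 c, e * x ≠ 0

variable (k : Type) [Field k] (A : Type) [Ring A] [Algebra k A]
variable (𝒜 : ℕ → Submodule k A) [GradedAlgebra 𝒜] (c : ℕ)

theorem eq_zero_of_isIdempotentElem_of_upperTriangular_of_diag_eq_zero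
    {R : Type*} [Ring R] {n : ℕ} {E : Matrix (Fin n) (Fin n) R} (hE : IsIdempotentElem E)
    (hlow : ∀ i j : Fin n, j < i → E i j = 0) (hdiag : ∀ i, E i i = 0) : E = 0 := by
  have hle : ∀ i j : Fin n, j ≤ i → E i j = 0 := by
    intro i j hji
    rcases hji.lt_or_eq with h | rfl
    · exact hlow i j h
    · exact hdiag j
  ext i j
  induction j using WellFoundedLT.induction with
  | ind j ih =>
    rw [← hE.eq, Matrix.mul_apply]
    refine Finset.sum_eq_zero fun l _ => ?_
    rcases lt_or_ge l j with h | h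
    · rw [ih l h, Matrix.zero_apply, zero_mul]
    · rw [hle l j h, mul_zero]

theorem single_mem_bei (i : Fin c) {e : A} (he : e ∈ 𝒜 0) :
    Matrix.single i i e ∈ bei k A 𝒜 c := by
  intro l j
  rw [Matrix.single_apply]
  split_ifs with h
  · obtain ⟨rfl, rfl⟩ := h
    exact ⟨fun _ => by simpa using he, fun h => absurd h (lt_irrefl _)⟩
  · exact ⟨fun _ => Submodule.zero_mem _, fun _ => rfl⟩

theorem single_mem_xA (i : Fin c) {x : A} (hx : x ∈ 𝒜 c) :
    Matrix.single i i x ∈ xA k A 𝒜 c := by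
  intro l j
  rw [Matrix.single_apply]
  split_ifs with h
  · obtain ⟨rfl, rfl⟩ := h
    exact ⟨fun _ => by simpa using hx, fun h => absurd h (lt_irrefl _)⟩
  · exact ⟨fun _ => Submodule.zero_mem _, fun _ => rfl⟩

theorem isIdempotentElem_diag_of_mem_bei {E : Matrix (Fin c) (Fin c) A}
    (hE : E ∈ bei k A 𝒜 c) (hidem : IsIdempotentElem E) (i : Fin c) :
    IsIdempotentElem (E i i) := by
  have h : (E * E) i i = E i i := by rw [hidem.eq]
  rw [Matrix.mul_apply, Finset.sum_eq_single i] at h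
  · exact h
  · intro l _ hl
    rcases lt_or_gt_of_ne hl with h | h
    · rw [(hE i l).2 h, zero_mul]
    · rw [(hE l i).2 h, mul_zero]
  · simp

theorem left_wellGraded_iff_tA_left_wellGraded
    [FiniteDimensional k A]
    (hc : 1 ≤ c) (hcne : 𝒜 c ≠ ⊥) (htop : ∀ n : ℕ, c < n → 𝒜 n = ⊥) :
    LeftWellGraded 𝒜 c ↔
      ∀ E : Matrix (Fin c) (Fin c) A, E ∈ bei k A 𝒜 c → IsIdempotentElem E → E ≠ 0 →
        ∃ X ∈ xA k A 𝒜 c, E * X ≠ 0 := by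
  constructor
  · intro hA E hE hidem hne
    obtain ⟨i, hi⟩ : ∃ i, E i i ≠ 0 := by
      by_contra! hdiag
      exact hne (eq_zero_of_isIdempotentElem_of_upperTriangular_of_diag_eq_zero hidem
        (fun i j => (hE i j).2) hdiag)
    obtain ⟨x, hx, hex⟩ := hA (E i i) (by simpa using (hE i i).1 le_rfl)
      (isIdempotentElem_diag_of_mem_bei k A 𝒜 c hE hidem i) hi
    refine ⟨Matrix.single i i x, single_mem_xA k A 𝒜 c i hx, fun h => hex ?_⟩
    simpa using congrFun (congrFun h i) i
  · intro hT e he hidem hne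
    let o : Fin c := ⟨0, hc⟩
    obtain ⟨X, hX, hEX⟩ := hT (Matrix.single o o e) (single_mem_bei k A 𝒜 c o he)
      (by rw [IsIdempotentElem, Matrix.single_mul_single_same, hidem.eq])
      (fun h => hne (by simpa using congrFun (congrFun h o) o))
    refine ⟨X o o, by simpa using (hX o o).1 le_rfl, fun h => hEX ?_⟩
    ext i j
    by_cases hi : i = o
    · subst hi
      rw [Matrix.single_mul_apply_same, Matrix.zero_apply]
      rcases Nat.eq_zero_or_pos (j : ℕ) with hj | hj
      · rwa [show j = o from Fin.ext hj]
      · rw [(hX o j).2 hj, mul_zero]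
    · rw [Matrix.single_mul_apply_of_ne _ _ _ _ _ hi, Matrix.zero_apply]
end

section
/- Let B be a basic finite-dimensional k-algebra, X a nonzero finite-dimensional B-bimodule on which k acts centrally, and suppose the trivial extension T = B ⋉ X is well-graded and self-injective (injective as a left module over itself). Then there exists a k-algebra automorphism σ of B and an isomorphism of B-bimodules X ≅ D(B^σ); in particular there is an isomorphism T ≅ T(B^σ) of graded algebras. -/
/-!
STATEMENT 7: Let `B` be a basic finite-dimensional `k`-algebra, `X` a nonzero
finite-dimensional `B`-bimodule on which `k` acts centrally, and suppose the trivial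
extension `T = B ⋉ X` is well-graded and self-injective.  Then there is a `k`-algebra
automorphism `σ` of `B` and an isomorphism of `B`-bimodules `X ≅ D(B^σ)`; in
particular there is an isomorphism `T ≅ T(B^σ)` of graded algebras.

`D(B^σ)` carries the left action `(b • f) y = f (y * σ b)` and right action
`(f • b) y = f (b * y)`; a `k`-linear isomorphism `φ : X ≃ D(B)` is a bimodule
isomorphism `X ≅ D(B^σ)` when `φ (b • x) y = φ x (y * σ b)` and
`φ (x • b) y = φ x (b * y)`.  The induced map `(b, x) ↦ (b, φ x)` is then an
isomorphism of graded algebras `T ≅ T(B^σ)` (identity in degree `0`, `φ` in degree `1`).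
-/

open CategoryTheory MulOpposite
set_option synthInstance.maxHeartbeats 1000000
set_option maxHeartbeats 1000000
set_option linter.unusedVariables false

section DualT
variable (k : Type) [Field k] (B : Type) [Ring B] [Algebra k B]

/-- `D(B^σ)`: the dual of the twisted bimodule `B^σ`; as a set it is `Hom_k(B,k)`, with
left `B`-action `(b • f) y = f (y * σ b)` and right `B`-action `(f • b) y = f (b * y)`. -/
def DualT (σ : B ≃ₐ[k] B) : Type := Module.Dual k B

variable (σ : B ≃ₐ[k] B)

/-- The twisted left action on the dual. -/
def dualTLeftModule : Module B (Module.Dual k B) where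
  smul b f := f.comp (LinearMap.mulRight k (σ b))
  one_smul f := by ext y; show f (y * σ 1) = f y; rw [map_one, mul_one]
  mul_smul b b' f := by
    ext y; show f (y * σ (b * b')) = f (y * σ b * σ b'); rw [map_mul σ b b', mul_assoc]
  smul_zero b := rfl
  smul_add b f g := rfl
  add_smul b b' f := by
    ext y; show f (y * σ (b + b')) = f (y * σ b) + f (y * σ b'); rw [map_add, mul_add, map_add]
  zero_smul f := by ext y; show f (y * σ 0) = 0; rw [map_zero, mul_zero, map_zero]

/-- The (untwisted) right action on the dual. -/
def dualTRightModule : Module Bᵐᵒᵖ (Module.Dual k B) where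
  smul b f := f.comp (LinearMap.mulLeft k (unop b))
  one_smul f := by ext y; show f (1 * y) = f y; rw [one_mul]
  mul_smul b b' f := by
    ext y; show f ((unop b' * unop b) * y) = f (unop b' * (unop b * y)); rw [mul_assoc]
  smul_zero b := rfl
  smul_add b f g := rfl
  add_smul b b' f := by
    ext y; show f ((unop b + unop b') * y) = f (unop b * y) + f (unop b' * y)
    rw [add_mul, map_add]
  zero_smul f := by ext y; show f (0 * y) = 0; rw [zero_mul, map_zero]

/-- Reinterpret an element of `DualT` as a linear functional. -/
def DualT.lin (f : DualT k B σ) : Module.Dual k B := f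

instance : AddCommGroup (DualT k B σ) := inferInstanceAs (AddCommGroup (Module.Dual k B))
instance : Module k (DualT k B σ) := inferInstanceAs (Module k (Module.Dual k B))
instance : Module B (DualT k B σ) := dualTLeftModule k B σ
instance : Module Bᵐᵒᵖ (DualT k B σ) := dualTRightModule k B

instance : SMulCommClass B Bᵐᵒᵖ (DualT k B σ) where
  smul_comm b b' f :=
    LinearMap.ext (fun y => congrArg (DualT.lin k B σ f) (mul_assoc (unop b') y (σ b)).symm)

instance : IsScalarTower k B (DualT k B σ) where
  smul_assoc r b f := LinearMap.ext (fun y => by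
    change DualT.lin k B σ f (y * σ (r • b)) = r • DualT.lin k B σ f (y * σ b)
    rw [map_smul σ, mul_smul_comm, map_smul])

instance : IsScalarTower k Bᵐᵒᵖ (DualT k B σ) where
  smul_assoc r b f := LinearMap.ext (fun y => by
    change DualT.lin k B σ f ((unop (r • b)) * y) = r • DualT.lin k B σ f (unop b * y)
    rw [unop_smul, smul_mul_assoc, map_smul])

noncomputable example : Ring (TrivSqZeroExt B (DualT k B σ)) := inferInstance
noncomputable example : Algebra k (TrivSqZeroExt B (DualT k B σ)) := inferInstance

end DualT

/-- `e` is a primitive idempotent. -/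
def IsPrimitiveIdem {B : Type} [Ring B] (e : B) : Prop :=
  IsIdempotentElem e ∧ e ≠ 0 ∧
    ∀ f g : B, IsIdempotentElem f → IsIdempotentElem g → f ≠ 0 → g ≠ 0 →
      f * g = 0 → g * f = 0 → e ≠ f + g

/-- The left ideal `Be`. -/
def leftIdeal {B : Type} [Ring B] (e : B) : Submodule B B :=
  LinearMap.range (LinearMap.toSpanSingleton B B e)

/-- A ring is basic if in any decomposition of the unity into pairwise orthogonal
primitive idempotents, distinct idempotents generate non-isomorphic left ideals. -/
def IsBasicAlgebra (B : Type) [Ring B] : Prop :=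
  ∀ (l : ℕ) (e : Fin l → B), (∀ i, IsPrimitiveIdem (e i)) →
    (∀ i j, i ≠ j → e i * e j = 0) → (∑ i, e i = 1) →
    ∀ i j, i ≠ j → IsEmpty (↥(leftIdeal (e i)) ≃ₗ[B] ↥(leftIdeal (e j)))

section Idempotents

variable {B : Type} [Ring B]

/-- A nonzero idempotent of the corner `eBe` of a primitive idempotent `e` equals `e`. -/
lemma IsPrimitiveIdem.eq_of_mul_eq {e f : B} (he : IsPrimitiveIdem e) (hf : IsIdempotentElem f)
    (h0 : f ≠ 0) (hl : e * f = f) (hr : f * e = f) : f = e := by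
  by_contra hne
  have hfe : f * (e - f) = 0 := by rw [mul_sub, hr, hf.eq, sub_self]
  have hef : (e - f) * f = 0 := by rw [sub_mul, hl, hf.eq, sub_self]
  have hidem : IsIdempotentElem (e - f) := by
    show (e - f) * (e - f) = e - f
    rw [sub_mul, hfe, sub_zero, mul_sub, he.1.eq, hl]
  exact he.2.2 f (e - f) hf hidem h0 (sub_ne_zero.mpr (Ne.symm hne)) hfe hef (by abel)

/-- Mutually inverse elements of `eBf` and `fBe` induce an isomorphism `Be ≃ Bf`. -/
def leftIdealEquiv {e f a b : B} (hab : a * b = e) (hba : b * a = f) (haf : a * f = a)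
    (hbe : b * e = b) (he : IsIdempotentElem e) (hf : IsIdempotentElem f) :
    leftIdeal e ≃ₗ[B] leftIdeal f :=
  LinearEquiv.ofLinearMap
    (((LinearMap.toSpanSingleton B B a).comp (leftIdeal e).subtype).codRestrict (leftIdeal f)
      (fun y => ⟨(y : B) * a, by simp [mul_assoc, haf]⟩))
    (((LinearMap.toSpanSingleton B B b).comp (leftIdeal f).subtype).codRestrict (leftIdeal e)
      (fun y => ⟨(y : B) * b, by simp [mul_assoc, hbe]⟩))
    (by
      ext ⟨_, y, rfl⟩
      show y * f * b * a = y * f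
      rw [mul_assoc, hba, mul_assoc, hf.eq])
    (by
      ext ⟨_, y, rfl⟩
      show y * e * a * b = y * e
      rw [mul_assoc, hab, mul_assoc, he.eq])

/-- The Fitting lemma for the corner ring of a primitive idempotent. -/
lemma IsPrimitiveIdem.isUnit_or_isNilpotent (k : Type) [Field k] [Algebra k B]
    [FiniteDimensional k B] {e : B} (he : IsPrimitiveIdem e) {a : B} (hl : e * a = a) (hr : a * e = a) :
    (∃ c, e * c = c ∧ c * e = c ∧ a * c = e ∧ c * a = e) ∨ IsNilpotent a := by
  obtain ⟨q, hq, hndvd⟩ := Polynomial.exists_eq_pow_rootMultiplicity_mul_and_not_dvd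
    (minpoly k a) (minpoly.ne_zero (Algebra.IsIntegral.isIntegral a)) 0
  set n := Polynomial.rootMultiplicity 0 (minpoly k a)
  rw [Polynomial.C_0, sub_zero] at hq hndvd
  have hcop : IsCoprime ((Polynomial.X : Polynomial k) ^ (n + 1)) q :=
    ((Polynomial.irreducible_X.coprime_iff_not_dvd).mpr hndvd).pow_left
  obtain ⟨u, v, huv⟩ := hcop
  set U := Polynomial.aeval a u
  set V := Polynomial.aeval a (v * q)
  have hUV : U * a ^ (n + 1) + V = 1 := by
    simpa [U, V] using congrArg (Polynomial.aeval a) huv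
  have hUa : Commute U a := by
    simpa [U] using (Commute.all u Polynomial.X).map (Polynomial.aeval a)
  have hUV' : Commute U V := (Commute.all u (v * q)).map (Polynomial.aeval a)
  have haV : a ^ (n + 1) * V = 0 := by
    have hann : (Polynomial.aeval a) (Polynomial.X ^ (n + 1) * (v * q)) = 0 := by
      have : Polynomial.X ^ (n + 1) * (v * q) = minpoly k a * (Polynomial.X * v) := by
        rw [hq]; ring
      rw [this, map_mul, minpoly.aeval, zero_mul]
    simpa [V] using hann
  have hidem : IsIdempotentElem (U * a ^ (n + 1)) := by
    have : U * a ^ (n + 1) * (U * a ^ (n + 1) + V) = U * a ^ (n + 1) := by rw [hUV, mul_one]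
    rwa [mul_add, mul_assoc U _ V, haV, mul_zero, add_zero] at this
  have hcomm : Commute (U * a ^ n) a := hUa.mul_left (Commute.pow_self a n)
  have hfr : U * a ^ (n + 1) = U * a ^ n * a := by rw [pow_succ, mul_assoc]
  have hfl : U * a ^ (n + 1) = a * (U * a ^ n) := by rw [hfr, hcomm.eq]
  by_cases h0 : U * a ^ (n + 1) = 0
  · right
    refine ⟨n + 1, ?_⟩
    rw [h0, zero_add] at hUV
    rwa [hUV, mul_one] at haV
  · left
    have hfe := he.eq_of_mul_eq hidem h0 (by rw [hfl, ← mul_assoc, hl])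
      (by rw [hfr, mul_assoc, hr])
    refine ⟨e * (U * a ^ n) * e, ?_, ?_, ?_, ?_⟩
    · rw [← mul_assoc, ← mul_assoc, he.1.eq]
    · rw [mul_assoc, he.1.eq]
    · rw [← mul_assoc, ← mul_assoc, hr, ← hfl, hfe, he.1.eq]
    · rw [mul_assoc, hl, mul_assoc, ← hfr, hfe, he.1.eq]

/-- If a finite sum of elements of `eBe`, with `e` primitive, equals `e`, then one of the
summands is invertible in `eBe`. -/
lemma IsPrimitiveIdem.exists_unit_of_sum_eq (k : Type) [Field k] [Algebra k B]
    [FiniteDimensional k B] {e : B} (he : IsPrimitiveIdem e) {ι : Type} (s : Finset ι) (c : ι → B)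
    (hl : ∀ i, e * c i = c i) (hr : ∀ i, c i * e = c i)
    (hsum : ∑ i ∈ s, c i = e) :
    ∃ i ∈ s, ∃ d, e * d = d ∧ d * e = d ∧ c i * d = e ∧ d * c i = e := by
  have mem_corner : ∀ a : B, e * a = a → a * e = a → a ∈ NonUnitalRing.corner e :=
    fun a h h' => (Subsemigroup.mem_corner_iff he.1).mpr ⟨h, h'⟩
  have : Nontrivial he.1.Corner :=
    ⟨⟨1, 0, fun h => he.2.1 (congrArg Subtype.val h)⟩⟩
  have : IsLocalRing he.1.Corner := by
    refine IsLocalRing.of_isUnit_or_isUnit_one_sub_self fun a => ?_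
    obtain ⟨ha, ha'⟩ := (Subsemigroup.mem_corner_iff he.1).mp a.2
    rcases he.isUnit_or_isNilpotent k ha ha' with ⟨c, h1, h2, h3, h4⟩ | ⟨n, hn⟩
    · exact Or.inl ⟨⟨a, ⟨c, mem_corner c h1 h2⟩, Subtype.ext h3, Subtype.ext h4⟩, rfl⟩
    · refine Or.inr (IsNilpotent.isUnit_one_sub ⟨n + 1, Subtype.ext ?_⟩)
      have hpow : ∀ m : ℕ, (a ^ (m + 1)).1 = a.1 ^ (m + 1) := by
        intro m
        induction m with
        | zero => simp
        | succ m ih => rw [pow_succ, pow_succ a.1, ← ih]; rfl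
      rw [hpow, pow_succ, hn, zero_mul]; rfl
  let c' : ι → he.1.Corner := fun i => ⟨c i, mem_corner _ (hl i) (hr i)⟩
  have hsum' : ∑ i ∈ s, c' i = 1 := by
    refine Subtype.ext (Eq.trans ?_ hsum)
    exact map_sum (NonUnitalRing.corner e).toAddSubgroup.subtype c' s
  obtain ⟨i, hi, u, hu⟩ := IsLocalRing.exists_of_isUnit_sum (hsum' ▸ isUnit_one)
  obtain ⟨hd, hd'⟩ := (Subsemigroup.mem_corner_iff he.1).mp (u⁻¹ : he.1.Cornerˣ).1.2
  refine ⟨i, hi, _, hd, hd', ?_, ?_⟩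
  · have := congrArg Subtype.val u.mul_inv
    rw [hu] at this; exact this
  · have := congrArg Subtype.val u.inv_mul
    rw [hu] at this; exact this

/-- In a finite-dimensional algebra every idempotent is a sum of pairwise orthogonal primitive
idempotents. -/
lemma exists_finset_primitiveIdem (k : Type) [Field k] [Algebra k B] [FiniteDimensional k B]
    (e : B) (he : IsIdempotentElem e) :
    ∃ S : Finset B, (∀ x ∈ S, IsPrimitiveIdem x) ∧
      (∀ x ∈ S, ∀ y ∈ S, x ≠ y → x * y = 0) ∧ ∑ x ∈ S, x = e := by
  classical
  induction hn : Module.finrank k (LinearMap.range (LinearMap.mulLeft k e))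
    using Nat.strong_induction_on generalizing e with
  | _ n ih =>
    subst hn
    by_cases h0 : e = 0
    · exact ⟨∅, by simp, by simp, by simp [h0]⟩
    by_cases hp : IsPrimitiveIdem e
    · exact ⟨{e}, by simp [hp], by simp, by simp⟩
    have hsplit : ∃ f g : B, IsIdempotentElem f ∧ IsIdempotentElem g ∧ f ≠ 0 ∧ g ≠ 0 ∧
        f * g = 0 ∧ g * f = 0 ∧ e = f + g := by
      by_contra hcon
      push Not at hcon
      exact hp ⟨he, h0, hcon⟩
    obtain ⟨f, g, hf, hg, hf0, hg0, hfg, hgf, rfl⟩ := hsplit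
    have hlt : ∀ a b : B, IsIdempotentElem a → IsIdempotentElem b → b ≠ 0 → a * b = 0 →
        b * a = 0 → Module.finrank k (LinearMap.range (LinearMap.mulLeft k a)) <
          Module.finrank k (LinearMap.range (LinearMap.mulLeft k (a + b))) := by
      intro a b ha hb hb0 hab hba
      refine Submodule.finrank_lt_finrank_of_lt (lt_of_le_of_ne ?_ ?_)
      · rintro _ ⟨y, rfl⟩
        exact ⟨a * y, by simp [add_mul, ← mul_assoc, ha.eq, hba]⟩
      · intro heq
        have hmem : b ∈ LinearMap.range (LinearMap.mulLeft k (a + b)) :=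
          ⟨b, by simp [add_mul, hab, hb.eq]⟩
        rw [← heq] at hmem
        obtain ⟨y, hy⟩ := hmem
        refine hb0 ?_
        calc b = a * y := hy.symm
          _ = a * (a * y) := by rw [← mul_assoc, ha.eq]
          _ = a * b := congrArg (a * ·) hy
          _ = 0 := hab
    obtain ⟨S, hS1, hS2, hS3⟩ := ih _ (hlt f g hf hg hg0 hfg hgf) f hf rfl
    obtain ⟨S', hS1', hS2', hS3'⟩ := ih _ (add_comm g f ▸ hlt g f hg hf hf0 hgf hfg) g hg rfl
    have absorb : ∀ (A : Finset B), (∀ x ∈ A, IsPrimitiveIdem x) →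
        (∀ x ∈ A, ∀ y ∈ A, x ≠ y → x * y = 0) → ∀ x ∈ A,
        (∑ y ∈ A, y) * x = x ∧ x * ∑ y ∈ A, y = x := by
      intro A h1 h2 x hx
      rw [Finset.sum_mul, Finset.mul_sum]
      refine ⟨(Finset.sum_eq_single_of_mem x hx fun y hy hyx => h2 y hy x hx hyx).trans
        (h1 x hx).1.eq, (Finset.sum_eq_single_of_mem x hx fun y hy hyx =>
          h2 x hx y hy hyx.symm).trans (h1 x hx).1.eq⟩
    have hcross : ∀ x ∈ S, ∀ y ∈ S', x * y = 0 ∧ y * x = 0 := by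
      intro x hx y hy
      obtain ⟨hx1, hx2⟩ := absorb S hS1 hS2 x hx
      obtain ⟨hy1, hy2⟩ := absorb S' hS1' hS2' y hy
      rw [hS3] at hx1 hx2
      rw [hS3'] at hy1 hy2
      constructor
      · rw [← hx2, ← hy1, mul_assoc, ← mul_assoc f, hfg, zero_mul, mul_zero]
      · rw [← hy2, ← hx1, mul_assoc, ← mul_assoc g, hgf, zero_mul, mul_zero]
    have hdisj : Disjoint S S' := Finset.disjoint_left.mpr fun x hx hx' =>
      (hS1 x hx).2.1 ((hS1 x hx).1.eq.symm.trans (hcross x hx x hx').1)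
    refine ⟨S ∪ S', ?_, ?_, by rw [Finset.sum_union hdisj, hS3, hS3']⟩
    · intro x hx
      exact (Finset.mem_union.mp hx).elim (hS1 x) (hS1' x)
    · intro x hx y hy hxy
      rcases Finset.mem_union.mp hx with hx | hx <;> rcases Finset.mem_union.mp hy with hy | hy
      · exact hS2 x hx y hy hxy
      · exact (hcross x hx y hy).1
      · exact (hcross y hy x hx).2
      · exact hS2' x hx y hy hxy

end Idempotents

section RightAction

variable {B : Type} [Ring B]

/-- Every `B`-linear endomorphism is the action of a unique element of `Bᵐᵒᵖ`. -/
def IsRightBalanced (B : Type) [Ring B] (X : Type) [AddCommGroup X] [Module B X]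
    [Module Bᵐᵒᵖ X] : Prop :=
  (∀ b c : B, (∀ x : X, op b • x = op c • x) → b = c) ∧
    ∀ h : X →ₗ[B] X, ∃ b : B, ∀ x, h x = op b • x

/-- The right action of `b`, as a left `B`-linear map. -/
def rightAct (X : Type) [AddCommGroup X] [Module B X] [Module Bᵐᵒᵖ X] [SMulCommClass B Bᵐᵒᵖ X]
    (b : B) : X →ₗ[B] X where
  toFun x := op b • x
  map_add' := smul_add _
  map_smul' c x := (smul_comm c (op b) x).symm

variable {X M : Type} [AddCommGroup X] [Module B X] [Module Bᵐᵒᵖ X] [SMulCommClass B Bᵐᵒᵖ X]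
  [AddCommGroup M] [Module B M] [Module Bᵐᵒᵖ M] [SMulCommClass B Bᵐᵒᵖ M]

@[simp] lemma rightAct_apply (b : B) (x : X) : rightAct X b x = op b • x := rfl

/-- Mutually inverse isomorphisms between the summands `Xe` of `X` and `Mf` of `M`, extended by
zero to `X` and `M`. -/
structure SummandIso (X M : Type) [AddCommGroup X] [Module B X] [Module Bᵐᵒᵖ X]
    [AddCommGroup M] [Module B M] [Module Bᵐᵒᵖ M] (e f : B) where
  hom : X →ₗ[B] M
  inv : M →ₗ[B] X
  hom_smul : ∀ x, hom (op e • x) = hom x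
  smul_hom : ∀ x, op f • hom x = hom x
  inv_smul : ∀ m, inv (op f • m) = inv m
  smul_inv : ∀ m, op e • inv m = inv m
  inv_hom : ∀ x, inv (hom x) = op e • x
  hom_inv : ∀ m, hom (inv m) = op f • m

/-- If `X` is a direct summand of a finite power of `M`, and `X`, `M` have endomorphism ring
`Bᵐᵒᵖ`, then each `Xe` with `e` primitive is isomorphic to one of the summands of `M`. -/
lemma exists_summandIso (k : Type) [Field k] [Algebra k B] [FiniteDimensional k B]
    (hX : IsRightBalanced B X) (hM : IsRightBalanced B M) {N : ℕ}
    (p : Fin N → X →ₗ[B] M) (q : Fin N → M →ₗ[B] X) (hqp : ∀ x, ∑ n, q n (p n x) = x)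
    {l : ℕ} (e : Fin l → B) (hprim : ∀ i, IsPrimitiveIdem (e i)) (hsum : ∑ i, e i = 1)
    {a : B} (ha : IsPrimitiveIdem a) :
    ∃ j, Nonempty (SummandIso X M a (e j)) := by
  choose c hc using fun nj : Fin N × Fin l =>
    hX.2 (rightAct X a ∘ₗ q nj.1 ∘ₗ rightAct M (e nj.2) ∘ₗ p nj.1 ∘ₗ rightAct X a)
  simp only [LinearMap.comp_apply, rightAct_apply] at hc
  have hsumM : ∀ m : M, ∑ j, op (e j) • m = m := fun m => by
    rw [← Finset.sum_smul, ← Finset.op_sum, hsum, op_one, one_smul]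
  have idem : ∀ {b : B}, IsPrimitiveIdem b → op b * op b = op b := fun h => by
    rw [← op_mul, h.1.eq]
  obtain ⟨⟨n, j⟩, -, d, hd1, hd2, hcd, hdc⟩ := ha.exists_unit_of_sum_eq k Finset.univ c
    (fun nj => hX.1 _ _ fun x => by
      rw [op_mul, mul_smul, ← hc, ← hc, ← mul_smul (op a) (op a), idem ha])
    (fun nj => hX.1 _ _ fun x => by
      rw [op_mul, mul_smul, ← hc, ← mul_smul, idem ha])
    (hX.1 _ _ fun x => by
      rw [Finset.op_sum, Finset.sum_smul, Fintype.sum_prod_type]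
      simp only [← hc, ← Finset.smul_sum, ← map_sum, hsumM, hqp]
      rw [← mul_smul, idem ha])
  have hinvhom : ∀ x : X, op d • op a • q n (op (e j) • op (e j) • p n (op a • x)) = op a • x := by
    intro x
    rw [← mul_smul (op (e j)), idem (hprim j), hc (n, j), ← mul_smul, ← op_mul, hcd]
  let α : X →ₗ[B] M := rightAct M (e j) ∘ₗ p n ∘ₗ rightAct X a
  let β : M →ₗ[B] X := rightAct X d ∘ₗ rightAct X a ∘ₗ q n ∘ₗ rightAct M (e j)
  have hβα : ∀ x, β (α x) = op a • x := hinvhom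
  have hα1 : ∀ x, α (op a • x) = α x := fun x => by
    simp only [α, LinearMap.comp_apply, rightAct_apply]
    rw [← mul_smul (op a), idem ha]
  have hα2 : ∀ x, op (e j) • α x = α x := fun x => by
    simp only [α, LinearMap.comp_apply, rightAct_apply]
    rw [← mul_smul (op (e j)), idem (hprim j)]
  have hβ1 : ∀ m, β (op (e j) • m) = β m := fun m => by
    simp only [β, LinearMap.comp_apply, rightAct_apply]
    rw [← mul_smul (op (e j)), idem (hprim j)]
  have hβ2 : ∀ m, op a • β m = β m := fun m => by
    simp only [β, LinearMap.comp_apply, rightAct_apply]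
    rw [← mul_smul (op a) (op d), ← op_mul, hd2]
  obtain ⟨g, hg⟩ := hM.2 (α ∘ₗ β)
  simp only [LinearMap.comp_apply] at hg
  have hge : g = e j := by
    refine (hprim j).eq_of_mul_eq (hM.1 _ _ fun m => ?_) ?_ (hM.1 _ _ fun m => ?_)
      (hM.1 _ _ fun m => ?_)
    · rw [op_mul, mul_smul, ← hg, ← hg, hβα, hα1]
    · intro h0
      refine ha.2.1 (hX.1 _ _ fun x => ?_)
      rw [← hβα, ← hα1, ← hβα, hg, h0]
      simp
    · rw [op_mul, mul_smul, ← hg, ← hg, hβ1]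
    · rw [op_mul, mul_smul, ← hg, hα2]
  exact ⟨j, ⟨⟨α, β, hα1, hα2, hβ1, hβ2, hβα, fun m => by rw [hg, hge]⟩⟩⟩

/-- Over a basic algebra, two modules with endomorphism ring `Bᵐᵒᵖ` are isomorphic as soon as one
is a direct summand of a finite power of the other. -/
lemma nonempty_linearEquiv_of_isRightBalanced (k : Type) [Field k] [Algebra k B]
    [FiniteDimensional k B] (hbasic : IsBasicAlgebra B)
    (hX : IsRightBalanced B X) (hM : IsRightBalanced B M) {N : ℕ}
    (p : Fin N → X →ₗ[B] M) (q : Fin N → M →ₗ[B] X) (hqp : ∀ x, ∑ n, q n (p n x) = x) :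
    Nonempty (X ≃ₗ[B] M) := by
  classical
  obtain ⟨S, hS1, hS2, hS3⟩ := exists_finset_primitiveIdem k (1 : B) IsIdempotentElem.one
  let e : Fin S.card → B := fun i => (S.equivFin.symm i : B)
  have hprim : ∀ i, IsPrimitiveIdem (e i) := fun i => hS1 _ (S.equivFin.symm i).2
  have horth : ∀ i j, i ≠ j → e i * e j = 0 := fun i j hij =>
    hS2 _ (S.equivFin.symm i).2 _ (S.equivFin.symm j).2 fun h =>
      hij (S.equivFin.symm.injective (Subtype.ext h))
  have hsum : ∑ i, e i = 1 := by
    rw [← hS3, ← Finset.sum_coe_sort S]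
    exact S.equivFin.symm.sum_comp fun x : S => (x : B)
  choose π hπ using fun i => exists_summandIso k hX hM p q hqp e hprim hsum (hprim i)
  let s : ∀ i, SummandIso X M (e i) (e (π i)) := fun i => (hπ i).some
  have hinj : Function.Injective π := by
    intro i i' hii
    by_contra hne
    obtain ⟨c, hc⟩ := hX.2 ((s i').inv ∘ₗ (s i).hom)
    obtain ⟨d, hd⟩ := hX.2 ((s i).inv ∘ₗ (s i').hom)
    simp only [LinearMap.comp_apply] at hc hd
    have hsm : ∀ x, op (e (π i)) • (s i').hom x = (s i').hom x := fun x => by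
      rw [hii, (s i').smul_hom]
    have hsm' : ∀ x, op (e (π i')) • (s i).hom x = (s i).hom x := fun x => by
      rw [← hii, (s i).smul_hom]
    refine (hbasic _ e hprim horth hsum i i' hne).false
      (leftIdealEquiv (a := c) (b := d) (hX.1 _ _ fun x => ?_) (hX.1 _ _ fun x => ?_)
        (hX.1 _ _ fun x => ?_) (hX.1 _ _ fun x => ?_) (hprim i).1 (hprim i').1)
    · rw [op_mul, mul_smul, ← hc, ← hd, (s i').hom_inv, hsm', (s i).inv_hom]
    · rw [op_mul, mul_smul, ← hd, ← hc, (s i).hom_inv, hsm, (s i').inv_hom]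
    · rw [op_mul, mul_smul, ← hc, (s i').smul_inv]
    · rw [op_mul, mul_smul, ← hd, (s i).smul_inv]
  have hbij : Function.Bijective π := Finite.injective_iff_bijective.mp hinj
  have hhom0 : ∀ i i' m, i ≠ i' → (s i).hom ((s i').inv m) = 0 := fun i i' m h => by
    rw [← (s i).hom_smul, ← (s i').smul_inv, ← mul_smul, ← op_mul, horth _ _ h.symm]
    simp
  have hinv0 : ∀ i i' x, i ≠ i' → (s i).inv ((s i').hom x) = 0 := fun i i' x h => by
    rw [← (s i).inv_smul, ← (s i').smul_hom, ← mul_smul, ← op_mul,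
      horth _ _ (hinj.ne h.symm)]
    simp
  refine ⟨LinearEquiv.ofLinearMap (∑ i, (s i).hom) (∑ i, (s i).inv)
    (LinearMap.ext fun m => ?_) (LinearMap.ext fun x => ?_)⟩
  · simp only [LinearMap.comp_apply, LinearMap.sum_apply, map_sum, LinearMap.id_apply]
    have : ∀ i', ∑ i, (s i).hom ((s i').inv m) = op (e (π i')) • m := fun i' => by
      rw [Finset.sum_eq_single_of_mem i' (Finset.mem_univ _) fun i _ hi => hhom0 i i' m hi,
        (s i').hom_inv]
    simp only [this]
    rw [← Finset.sum_smul, ← Finset.op_sum, hbij.sum_comp e, hsum, op_one, one_smul]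
  · simp only [LinearMap.comp_apply, LinearMap.sum_apply, map_sum, LinearMap.id_apply]
    have : ∀ i', ∑ i, (s i).inv ((s i').hom x) = op (e i') • x := fun i' => by
      rw [Finset.sum_eq_single_of_mem i' (Finset.mem_univ _) fun i _ hi => hinv0 i i' x hi,
        (s i').inv_hom]
    simp only [this]
    rw [← Finset.sum_smul, ← Finset.op_sum, hsum, op_one, one_smul]

end RightAction

section TrivialExtension

variable {B X : Type} [Ring B] [AddCommGroup X] [Module B X] [Module Bᵐᵒᵖ X]
  [SMulCommClass B Bᵐᵒᵖ X]

/-- Self-injectivity of `B ⋉ X`: linear maps from a left ideal are right multiplications. -/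
lemma exists_mul_right_of_injective
    (hinj : Module.Injective (TrivSqZeroExt B X) (TrivSqZeroExt B X))
    (I : Ideal (TrivSqZeroExt B X)) (g : I →ₗ[TrivSqZeroExt B X] TrivSqZeroExt B X) :
    ∃ t : TrivSqZeroExt B X, ∀ y : I, g y = y * t := by
  obtain ⟨g', hg'⟩ := Module.Baer.of_injective hinj I g
  refine ⟨g' 1, fun y => ?_⟩
  rw [← smul_eq_mul, ← map_smul, smul_eq_mul, mul_one, hg' y y.2]

/-- If `B ⋉ X` is self-injective and `Xe ≠ 0` for all nonzero idempotents `e`, then the right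
action of `B` on `X` is faithful. -/
lemma eq_zero_of_forall_op_smul_eq_zero
    (hwg : ∀ e : B, IsIdempotentElem e → e ≠ 0 → ∃ x : X, op e • x ≠ 0)
    (hinj : Module.Injective (TrivSqZeroExt B X) (TrivSqZeroExt B X))
    {b : B} (hb : ∀ x : X, op b • x = 0) : b = 0 := by
  let I : Ideal (TrivSqZeroExt B X) :=
    { carrier := {t | ∀ x : X, op t.fst • x = 0}
      add_mem' := fun {s t} hs ht x => by
        rw [TrivSqZeroExt.fst_add, MulOpposite.op_add, add_smul, hs, ht, add_zero]
      zero_mem' := fun x => by simp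
      smul_mem' := fun c t ht x => by
        rw [smul_eq_mul, TrivSqZeroExt.fst_mul, op_mul, mul_smul, ht] }
  let g : I →ₗ[TrivSqZeroExt B X] TrivSqZeroExt B X :=
    { toFun := fun t => TrivSqZeroExt.inl t.1.fst
      map_add' := fun s t => by simp
      map_smul' := fun c t => by
        ext
        · simp
        · simpa using (t.2 c.snd).symm }
  obtain ⟨t, ht⟩ := exists_mul_right_of_injective hinj I g
  have hfst : ∀ c : B, (∀ x : X, op c • x = 0) → c = c * t.fst := fun c hc => by
    have hmem : (TrivSqZeroExt.inl c : TrivSqZeroExt B X) ∈ I := hc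
    simpa [g] using congrArg TrivSqZeroExt.fst (ht ⟨_, hmem⟩)
  have hann : ∀ x : X, op t.fst • x = 0 := fun x => by
    have hmem : (TrivSqZeroExt.inr x : TrivSqZeroExt B X) ∈ I := fun y => by simp
    simpa [g] using (congrArg TrivSqZeroExt.snd (ht ⟨_, hmem⟩)).symm
  have h0 : t.fst = 0 := by
    by_contra hne
    obtain ⟨x, hx⟩ := hwg _ (hfst _ hann).symm hne
    exact hx (hann x)
  rw [hfst b hb, h0, mul_zero]

/-- For `B ⋉ X` self-injective, every left `B`-linear endomorphism of `X` is the right action of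
an element of `B`. -/
lemma exists_eq_op_smul_of_injective
    (hinj : Module.Injective (TrivSqZeroExt B X) (TrivSqZeroExt B X)) (h : X →ₗ[B] X) :
    ∃ b : B, ∀ x, h x = op b • x := by
  let I : Ideal (TrivSqZeroExt B X) :=
    { carrier := {t | t.fst = 0}
      add_mem' := fun {s t} hs ht => by
        show (s + t).fst = 0
        rw [TrivSqZeroExt.fst_add, hs, ht, add_zero]
      zero_mem' := rfl
      smul_mem' := fun c t ht => by
        show (c * t).fst = 0
        rw [TrivSqZeroExt.fst_mul, ht, mul_zero] }
  have hI : ∀ t : I, t.1.fst = 0 := fun t => t.2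
  let g : I →ₗ[TrivSqZeroExt B X] TrivSqZeroExt B X :=
    { toFun := fun t => TrivSqZeroExt.inr (h t.1.snd)
      map_add' := fun s t => by simp
      map_smul' := fun c t => by
        ext
        · simp
        · simp [hI] }
  obtain ⟨t, ht⟩ := exists_mul_right_of_injective hinj I g
  refine ⟨t.fst, fun x => ?_⟩
  have hmem : (TrivSqZeroExt.inr x : TrivSqZeroExt B X) ∈ I := TrivSqZeroExt.fst_inr B x
  simpa [g] using congrArg TrivSqZeroExt.snd (ht ⟨_, hmem⟩)

/-- If `B ⋉ X` is self-injective and `X` is a faithful right module, then `X` is an injective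
left `B`-module. -/
lemma injective_of_injective_trivSqZeroExt
    (hfaith : ∀ b : B, (∀ x : X, op b • x = 0) → b = 0)
    (hinj : Module.Injective (TrivSqZeroExt B X) (TrivSqZeroExt B X)) :
    Module.Injective B X where
  out Y Z _ _ _ _ i hi f := by
    let ε : TrivSqZeroExt B X →+* B := (TrivSqZeroExt.fstHom ℤ B X).toRingHom
    let _ : Module (TrivSqZeroExt B X) Y := Module.compHom Y ε
    let _ : Module (TrivSqZeroExt B X) Z := Module.compHom Z ε
    let i' : Y →ₗ[TrivSqZeroExt B X] Z :=
      { toFun := i, map_add' := i.map_add, map_smul' := fun t y => i.map_smul t.fst y }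
    let f' : Y →ₗ[TrivSqZeroExt B X] TrivSqZeroExt B X :=
      { toFun := fun y => TrivSqZeroExt.inr (f y)
        map_add' := fun y y' => by simp
        map_smul' := fun t y => by
          show TrivSqZeroExt.inr (f (t.fst • y)) = t * TrivSqZeroExt.inr (f y)
          ext <;> simp }
    obtain ⟨h, hh⟩ := hinj.out i' hi f'
    have hfst : ∀ z, (h z).fst = 0 := fun z => hfaith _ fun x => by
      have h1 : h ((TrivSqZeroExt.inr x : TrivSqZeroExt B X) • z) = 0 := by
        have : (TrivSqZeroExt.inr x : TrivSqZeroExt B X) • z = 0 := zero_smul B z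
        rw [this, map_zero]
      rw [map_smul] at h1
      simpa using congrArg TrivSqZeroExt.snd h1
    refine ⟨{ toFun := fun z => (h z).snd
              map_add' := fun z z' => by simp
              map_smul' := fun b z => ?_ }, fun y => ?_⟩
    · have h1 : h ((TrivSqZeroExt.inl b : TrivSqZeroExt B X) • z) =
          (TrivSqZeroExt.inl b : TrivSqZeroExt B X) • h z := map_smul _ _ _
      have h2 := congrArg TrivSqZeroExt.snd h1
      rw [smul_eq_mul, TrivSqZeroExt.snd_mul, TrivSqZeroExt.fst_inl, TrivSqZeroExt.snd_inl,
        smul_zero, add_zero] at h2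
      exact h2
    · exact congrArg TrivSqZeroExt.snd (hh y)

end TrivialExtension

section Dual

variable (k : Type) [Field k] (B : Type) [Ring B] [Algebra k B]

lemma DualT.smul_apply (σ : B ≃ₐ[k] B) (b : B) (f : DualT k B σ) (y : B) :
    (b • f).lin k B σ y = f.lin k B σ (y * σ b) := rfl

lemma DualT.op_smul_apply (σ : B ≃ₐ[k] B) (b : B) (f : DualT k B σ) (y : B) :
    (op b • f).lin k B σ y = f.lin k B σ (b * y) := rfl

/-- The endomorphism ring of the left module `D(B)` is `Bᵐᵒᵖ`. -/
lemma DualT.isRightBalanced_refl [FiniteDimensional k B] :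
    IsRightBalanced B (DualT k B AlgEquiv.refl) := by
  refine ⟨fun b c hbc => ?_, fun h => ?_⟩
  · rw [← sub_eq_zero]
    refine (Module.forall_dual_apply_eq_zero_iff k _).mp fun f => ?_
    have h1 : f (b * 1) = f (c * 1) := congrArg (fun g => DualT.lin k B AlgEquiv.refl g 1)
      (hbc (show DualT k B AlgEquiv.refl from f))
    rwa [mul_one, mul_one, ← sub_eq_zero, ← map_sub] at h1
  · let ev : Module.Dual k (Module.Dual k B) :=
      (LinearMap.applyₗ (1 : B)).comp (show Module.Dual k B →ₗ[k] Module.Dual k B from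
        h.restrictScalars k)
    obtain ⟨c, hc⟩ := (Module.evalEquiv k B).surjective ev
    refine ⟨c, fun f => LinearMap.ext fun y => ?_⟩
    have h1 : DualT.lin k B AlgEquiv.refl (h (y • f)) 1 =
        DualT.lin k B AlgEquiv.refl (y • f) c := (LinearMap.congr_fun hc _).symm
    rw [map_smul, DualT.smul_apply, DualT.smul_apply, one_mul] at h1
    exact h1

end Dual

section Embedding

variable (k : Type) [Field k] (B : Type) [Ring B] [Algebra k B] {X : Type} [AddCommGroup X]
  [Module B X] [Module k X] [IsScalarTower k B X]

/-- The left `B`-linear map `X → D(B)` induced by a functional on `X`. -/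
def dualOrbit (f : Module.Dual k X) : X →ₗ[B] DualT k B AlgEquiv.refl where
  toFun x := (f.comp (LinearMap.toSpanSingleton B X x |>.restrictScalars k) : Module.Dual k B)
  map_add' x y := LinearMap.ext fun b => by
    show f (b • (x + y)) = f (b • x) + f (b • y)
    rw [smul_add, map_add]
  map_smul' b x := LinearMap.ext fun c => by
    show f (c • b • x) = f ((c * b) • x)
    rw [mul_smul]

lemma dualOrbit_apply_one (f : Module.Dual k X) (x : X) :
    (dualOrbit k B f x).lin k B _ 1 = f x := congrArg f (one_smul B x)

/-- A finite-dimensional injective left module is a direct summand of a finite power of `D(B)`. -/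
lemma exists_dual_splitting [FiniteDimensional k X] (hinj : Module.Injective B X) :
    ∃ (N : ℕ) (p : Fin N → X →ₗ[B] DualT k B AlgEquiv.refl)
      (q : Fin N → DualT k B AlgEquiv.refl →ₗ[B] X), ∀ x, ∑ n, q n (p n x) = x := by
  classical
  let v := Module.finBasis k X
  let p := fun n => dualOrbit k B (v.coord n)
  have hp : Function.Injective (LinearMap.pi p) := by
    rw [← LinearMap.ker_eq_bot, LinearMap.ker_eq_bot']
    intro x hx
    refine v.ext_elem fun n => ?_
    have h1 : p n x = 0 := congrFun hx n
    have h2 := dualOrbit_apply_one k B (v.coord n) x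
    rw [map_zero, Finsupp.zero_apply, ← Module.Basis.coord_apply, ← h2]
    show DualT.lin k B _ (p n x) 1 = 0
    rw [h1]
    rfl
  obtain ⟨h, hh⟩ := hinj.out (LinearMap.pi p) hp LinearMap.id
  refine ⟨_, p, fun n => h.comp (LinearMap.single B (fun _ => DualT k B AlgEquiv.refl) n),
    fun x => ?_⟩
  simp only [LinearMap.comp_apply, ← map_sum]
  refine Eq.trans (congrArg h ?_) (hh x)
  exact LinearMap.sum_single_apply _ _

end Embedding

/-- A bimodule isomorphism induces an isomorphism of trivial extensions. -/
def trivSqZeroExtCongr {k B X Y : Type} [Field k] [Ring B] [Algebra k B]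
    [AddCommGroup X] [Module B X] [Module Bᵐᵒᵖ X] [SMulCommClass B Bᵐᵒᵖ X] [Module k X]
    [IsScalarTower k B X] [IsScalarTower k Bᵐᵒᵖ X]
    [AddCommGroup Y] [Module B Y] [Module Bᵐᵒᵖ Y] [SMulCommClass B Bᵐᵒᵖ Y] [Module k Y]
    [IsScalarTower k B Y] [IsScalarTower k Bᵐᵒᵖ Y] (φ : X ≃ₗ[k] Y)
    (hl : ∀ (b : B) x, φ (b • x) = b • φ x) (hr : ∀ (b : B) x, φ (op b • x) = op b • φ x) :
    TrivSqZeroExt B X ≃ₐ[k] TrivSqZeroExt B Y :=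
  AlgEquiv.ofLinearEquiv ((LinearEquiv.refl k B).prodCongr φ)
    (TrivSqZeroExt.ext rfl (map_zero φ))
    (fun s t => TrivSqZeroExt.ext rfl (by
      show φ (s.fst • t.snd + op t.fst • s.snd) = s.fst • φ t.snd + op t.fst • φ s.snd
      rw [map_add, hl, hr]))

/-- A left module isomorphism between bimodules with endomorphism ring `Bᵐᵒᵖ` intertwines the
right actions up to an automorphism of `B`. -/
lemma exists_algEquiv_of_isRightBalanced {k B X M : Type} [Field k] [Ring B] [Algebra k B]
    [AddCommGroup X] [Module B X] [Module Bᵐᵒᵖ X] [SMulCommClass B Bᵐᵒᵖ X] [Module k X]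
    [IsScalarTower k B X] [IsScalarTower k Bᵐᵒᵖ X]
    [AddCommGroup M] [Module B M] [Module Bᵐᵒᵖ M] [SMulCommClass B Bᵐᵒᵖ M] [Module k M]
    [IsScalarTower k B M] [IsScalarTower k Bᵐᵒᵖ M]
    (hX : IsRightBalanced B X) (hM : IsRightBalanced B M) (φ : X ≃ₗ[B] M) :
    ∃ τ : B ≃ₐ[k] B, ∀ b x, φ (op b • x) = op (τ b) • φ x := by
  choose τ hτ using fun b => hM.2 (φ.toLinearMap ∘ₗ rightAct X b ∘ₗ φ.symm.toLinearMap)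
  have hτ' : ∀ b x, φ (op b • x) = op (τ b) • φ x := fun b x => by
    simpa using hτ b (φ x)
  have hτ'' : ∀ b m, op (τ b) • m = φ (op b • φ.symm m) := fun b m => (hτ b m).symm
  have central : ∀ (r : k) (x : X), op (algebraMap k B r) • x = algebraMap k B r • x := by
    intro r x
    rw [algebraMap_smul, Algebra.algebraMap_eq_smul_one, op_smul, smul_assoc, op_one, one_smul]
  have central' : ∀ (r : k) (m : M), op (algebraMap k B r) • m = algebraMap k B r • m := by
    intro r m
    rw [algebraMap_smul, Algebra.algebraMap_eq_smul_one, op_smul, smul_assoc, op_one, one_smul]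
  let τ' : B →ₐ[k] B :=
    { toFun := τ
      map_one' := hM.1 _ _ fun m => by simp [hτ'']
      map_mul' := fun b c => hM.1 _ _ fun m => by
        rw [hτ'', op_mul, op_mul, mul_smul, mul_smul, hτ'' b, hτ'' c, φ.symm_apply_apply]
      map_zero' := hM.1 _ _ fun m => by simp [hτ'']
      map_add' := fun b c => hM.1 _ _ fun m => by
        rw [hτ'', MulOpposite.op_add, MulOpposite.op_add, add_smul, add_smul, hτ'', hτ'', map_add]
      commutes' := fun r => hM.1 _ _ fun m => by
        rw [hτ'', central, map_smul, φ.apply_symm_apply, central'] }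
  refine ⟨AlgEquiv.ofBijective τ' ⟨fun b c hbc => hX.1 _ _ fun x => φ.injective ?_,
    fun c => ?_⟩, hτ'⟩
  · rw [hτ', hτ', show τ b = τ c from hbc]
  · obtain ⟨b, hb⟩ := hX.2 (φ.symm.toLinearMap ∘ₗ rightAct M c ∘ₗ φ.toLinearMap)
    refine ⟨b, hM.1 _ _ fun m => ?_⟩
    show op (τ b) • m = op c • m
    rw [hτ'', ← hb]
    simp

theorem trivExt_wellGraded_selfInjective_is_twisted_trivExt
    (k : Type) [Field k] (B : Type) [Ring B] [Algebra k B] [FiniteDimensional k B]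
    (X : Type) [AddCommGroup X] [Module B X] [Module Bᵐᵒᵖ X] [SMulCommClass B Bᵐᵒᵖ X]
    [Module k X] [IsScalarTower k B X] [IsScalarTower k Bᵐᵒᵖ X] [FiniteDimensional k X]
    (hX : Nontrivial X)
    (hbasic : IsBasicAlgebra B)
    (hwg : ∀ e : B, IsIdempotentElem e → e ≠ 0 →
      (∃ x : X, e • x ≠ 0) ∧ (∃ x : X, op e • x ≠ 0))
    (hinj : Module.Injective (TrivSqZeroExt B X) (TrivSqZeroExt B X)) :
    ∃ (σ : B ≃ₐ[k] B) (φ : X ≃ₗ[k] Module.Dual k B),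
      (∀ (b : B) (x : X) (y : B), φ (b • x) y = φ x (y * σ b)) ∧
      (∀ (b : B) (x : X) (y : B), φ (op b • x) y = φ x (b * y)) ∧
      ∃ Ψ : TrivSqZeroExt B X ≃ₐ[k] TrivSqZeroExt B (DualT k B σ),
        (∀ b : B, Ψ (TrivSqZeroExt.inl b) = TrivSqZeroExt.inl b) ∧
        (∀ x : X, Ψ (TrivSqZeroExt.inr x) =
          TrivSqZeroExt.inr (show DualT k B σ from φ x)) := by
  have hfaith : ∀ b : B, (∀ x : X, op b • x = 0) → b = 0 := fun b =>
    eq_zero_of_forall_op_smul_eq_zero (fun e he h0 => (hwg e he h0).2) hinj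
  have hXbal : IsRightBalanced B X :=
    ⟨fun b c hbc => sub_eq_zero.mp (hfaith _ fun x => by
      rw [MulOpposite.op_sub, sub_smul, hbc, sub_self]), exists_eq_op_smul_of_injective hinj⟩
  have hMbal := DualT.isRightBalanced_refl k B
  obtain ⟨N, p, q, hqp⟩ :=
    exists_dual_splitting k B (injective_of_injective_trivSqZeroExt hfaith hinj)
  obtain ⟨φ₀⟩ := nonempty_linearEquiv_of_isRightBalanced k hbasic hXbal hMbal p q hqp
  obtain ⟨τ, hτ⟩ := exists_algEquiv_of_isRightBalanced (k := k) hXbal hMbal φ₀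
  let φ : X ≃ₗ[k] Module.Dual k B :=
    (show X ≃ₗ[k] Module.Dual k B from φ₀.restrictScalars k).trans τ.toLinearEquiv.dualMap
  have hφ : ∀ x y, φ x y = (φ₀ x).lin k B _ (τ y) := fun x y => rfl
  have hl : ∀ (b : B) (x : X) (y : B), φ (b • x) y = φ x (y * τ.symm b) := fun b x y => by
    rw [hφ, hφ, map_smul, DualT.smul_apply, map_mul τ, τ.apply_symm_apply]
    rfl
  have hr : ∀ (b : B) (x : X) (y : B), φ (op b • x) y = φ x (b * y) := fun b x y => by
    rw [hφ, hφ, hτ, DualT.op_smul_apply, map_mul τ]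
  exact ⟨τ.symm, φ, hl, hr,
    trivSqZeroExtCongr (Y := DualT k B τ.symm) φ (fun b x => LinearMap.ext (hl b x))
      (fun b x => LinearMap.ext (hr b x)),
    fun b => TrivSqZeroExt.ext rfl (map_zero φ), fun x => rfl⟩
end

section
/- Let B be a finite-dimensional k-algebra and M a finite-dimensional B-bimodule on which k acts centrally. If M ≅ B as left B-modules and M ≅ B as right B-modules, then there exists a k-algebra automorphism σ of B and an isomorphism of B-bimodules M ≅ B^σ. -/
/-!
STATEMENT 9: Let `B` be a finite-dimensional `k`-algebra and `M` a finite-dimensional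
`B`-bimodule on which `k` acts centrally.  If `M ≅ B` as left `B`-modules and `M ≅ B`
as right `B`-modules, then there is a `k`-algebra automorphism `σ` of `B` and an
isomorphism of `B`-bimodules `M ≅ B^σ`: a left `B`-linear isomorphism `ψ : M ≃ B`
intertwining the right action of `B` on `M` with the `σ`-twisted right action of `B`
on itself, i.e. `ψ (m · b) = ψ m * σ b`.
-/

open MulOpposite

theorem bimodule_free_of_rank_one_both_sides_is_twist
    (k : Type) [Field k] (B : Type) [Ring B] [Algebra k B] [FiniteDimensional k B]
    (M : Type) [AddCommGroup M] [Module B M] [Module Bᵐᵒᵖ M] [SMulCommClass B Bᵐᵒᵖ M]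
    [Module k M] [IsScalarTower k B M] [IsScalarTower k Bᵐᵒᵖ M] [FiniteDimensional k M]
    (hleft : Nonempty (M ≃ₗ[B] B)) (hright : Nonempty (M ≃ₗ[Bᵐᵒᵖ] B)) :
    ∃ (σ : B ≃ₐ[k] B) (ψ : M ≃ₗ[B] B),
      ∀ (b : B) (m : M), ψ (op b • m) = ψ m * σ b := by
  obtain ⟨φ⟩ := hleft
  obtain ⟨ρ⟩ := hright
  -- Right multiplication by `b` is determined by the image of `φ.symm 1 · b`.
  have hφ : ∀ (b : B) (m : M), φ (op b • m) = φ m * φ (op b • φ.symm 1) := fun b m => by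
    rw [← smul_eq_mul, ← map_smul, smul_comm, ← map_smul, smul_eq_mul, mul_one,
      φ.symm_apply_apply]
  have hφk : ∀ (c : k) (m : M), φ (c • m) = c • φ m := (φ.restrictScalars k).map_smul
  let f : B →ₐ[k] B := AlgHom.ofLinearMap
    { toFun := fun b => φ (op b • φ.symm 1)
      map_add' := fun a b => by rw [op_add, add_smul, map_add]
      map_smul' := fun c b => by rw [op_smul, smul_assoc, hφk, RingHom.id_apply] }
    (by simp)
    (fun a b => by
      change φ (op (a * b) • φ.symm 1) = φ (op a • φ.symm 1) * φ (op b • φ.symm 1)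
      rw [op_mul, mul_smul, hφ])
  have hf : ∀ (b : B) (m : M), φ (op b • m) = φ m * f b := hφ
  have f_injective : Function.Injective f := by
    refine (injective_iff_map_eq_zero f).2 fun b hb => ?_
    have hzero : op b • ρ.symm 1 = 0 := φ.injective (by rw [hf, hb, mul_zero, map_zero])
    simpa using congrArg ρ hzero
  exact ⟨AlgEquiv.ofBijective f
    ⟨f_injective, LinearMap.surjective_of_injective (f := f.toLinearMap) f_injective⟩, φ, hf⟩
end

section
/- Let A = ⊕_{n≥0} A_n be a positively graded finite-dimensional k-algebra with c ≥ 1, and let 1_{A_0} = e_1 + … + e_l be a decomposition of the unity of A_0 into pairwise orthogonal primitive idempotents. Then A is left well-graded if and only if e_i A_c ≠ 0 for every 1 ≤ i ≤ l. -/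
/-- `e` is a primitive idempotent of the subring whose underlying set is `S` (here: the
degree-zero component `A_0`): `e` is a nonzero idempotent of `S` which is not the sum
of two nonzero orthogonal idempotents of `S`. -/
def IsPrimitiveIdemIn {A : Type} [Ring A] (S : Set A) (e : A) : Prop :=
  e ∈ S ∧ IsIdempotentElem e ∧ e ≠ 0 ∧
    ∀ f g : A, f ∈ S → g ∈ S → IsIdempotentElem f → IsIdempotentElem g → f ≠ 0 → g ≠ 0 →
      f * g = 0 → g * f = 0 → e ≠ f + g

/-- In a finite-dimensional algebra every element is nilpotent or has a nonzero idempotent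
multiple which is a polynomial in that element. -/
theorem isNilpotent_or_exists_idempotent_aeval_mul {k R : Type*} [Field k] [Ring R] [Algebra k R]
    [FiniteDimensional k R] (a : R) :
    IsNilpotent a ∨ ∃ g : Polynomial k, IsIdempotentElem (Polynomial.aeval a g * a) ∧
      Polynomial.aeval a g * a ≠ 0 := by
  obtain ⟨q, hq, hnd⟩ := Polynomial.exists_eq_pow_rootMultiplicity_mul_and_not_dvd
    (minpoly k a) (minpoly.ne_zero (Algebra.IsIntegral.isIntegral a)) 0
  rw [map_zero, sub_zero] at hq hnd
  set n := (minpoly k a).rootMultiplicity 0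
  obtain ⟨u, v, huv⟩ : IsCoprime ((Polynomial.X : Polynomial k) ^ (n + 1)) q :=
    ((Polynomial.irreducible_X.coprime_iff_not_dvd).2 hnd).pow_left
  have hzero : a ^ n * Polynomial.aeval a q = 0 := by
    simpa [hq] using minpoly.aeval k a
  have hf : Polynomial.aeval a (u * Polynomial.X ^ n) * a =
      Polynomial.aeval a (u * Polynomial.X ^ (n + 1)) := by
    simp [pow_succ, mul_assoc]
  have hpow : Polynomial.aeval a (u * Polynomial.X ^ (n + 1)) * a ^ n = a ^ n := by
    have h := congrArg (Polynomial.aeval a) (congrArg (· * Polynomial.X ^ n) huv)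
    have h' : (u * Polynomial.X ^ (n + 1) + v * q) * Polynomial.X ^ n =
        u * Polynomial.X ^ (n + 1) * Polynomial.X ^ n + v * (Polynomial.X ^ n * q) := by ring
    simp only [h', map_add, map_mul, map_pow, Polynomial.aeval_X, hzero, mul_zero, add_zero,
      one_mul] at h
    simpa using h
  by_cases h0 : Polynomial.aeval a (u * Polynomial.X ^ (n + 1)) = 0
  · left
    exact ⟨n, by rw [← hpow, h0, zero_mul]⟩
  · right
    refine ⟨u * Polynomial.X ^ n, ?_, by rwa [hf]⟩
    have h' : u * Polynomial.X ^ (n + 1) * (u * Polynomial.X ^ (n + 1)) =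
        u * Polynomial.X * (u * Polynomial.X ^ (n + 1) * Polynomial.X ^ n) := by ring
    have h'' : u * Polynomial.X ^ (n + 1) = u * Polynomial.X * Polynomial.X ^ n := by ring
    rw [hf, IsIdempotentElem, ← map_mul, h', map_mul, map_mul _ _ (Polynomial.X ^ n), map_pow,
      Polynomial.aeval_X, hpow, h'', map_mul _ (u * Polynomial.X), map_pow, Polynomial.aeval_X]

/-- The corner ring of a primitive idempotent in a finite-dimensional algebra is local: an
element is nilpotent or has a left inverse. -/
theorem IsPrimitiveIdemIn.isNilpotent_or_exists_mul_eq {k R : Type} [Field k] [Ring R]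
    [Algebra k R] [FiniteDimensional k R] {p : R} (hp : IsPrimitiveIdemIn Set.univ p) {a : R}
    (hpa : p * a = a) (hap : a * p = a) : IsNilpotent a ∨ ∃ b, b * a = p := by
  obtain ha | ⟨g, hg, hg0⟩ := isNilpotent_or_exists_idempotent_aeval_mul (k := k) a
  · exact Or.inl ha
  right
  refine ⟨Polynomial.aeval a g, ?_⟩
  have hcomm : Polynomial.aeval a g * a = a * Polynomial.aeval a g := by
    have := congrArg (Polynomial.aeval a) (mul_comm g Polynomial.X)
    simpa using this
  have hfp : Polynomial.aeval a g * a * p = Polynomial.aeval a g * a := by rw [mul_assoc, hap]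
  have hpf : p * (Polynomial.aeval a g * a) = Polynomial.aeval a g * a := by
    rw [hcomm, ← mul_assoc, hpa]
  generalize Polynomial.aeval a g * a = f at *
  obtain ⟨-, hpi, -, hprim⟩ := hp
  by_contra hne
  have hfg : f * (p - f) = 0 := by rw [mul_sub, hfp, hg.eq, sub_self]
  have hgf : (p - f) * f = 0 := by rw [sub_mul, hpf, hg.eq, sub_self]
  refine hprim f (p - f) trivial trivial hg ?_ hg0 (sub_ne_zero.2 (Ne.symm hne)) hfg hgf
    (add_sub_cancel f p).symm
  rw [IsIdempotentElem, sub_mul, hfg, sub_zero, mul_sub, hpi.eq, hpf]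

/-- An element all of whose left multiples are nilpotent lies in the Jacobson radical. -/
theorem Ideal.mem_jacobson_bot_of_forall_isNilpotent {R : Type*} [Ring R] {x : R}
    (h : ∀ y, IsNilpotent (y * x)) : x ∈ Ideal.jacobson (⊥ : Ideal R) := by
  refine Ideal.mem_jacobson_iff.2 fun y => ?_
  obtain ⟨z, hz⟩ := (h y).isUnit_add_one.exists_left_inv
  refine ⟨z, ?_⟩
  rw [Ideal.mem_bot, ← hz]
  noncomm_ring

/-- An idempotent in the Jacobson radical is zero. -/
theorem IsIdempotentElem.eq_zero_of_mem_jacobson_bot {R : Type*} [Ring R] {e : R}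
    (he : IsIdempotentElem e) (hmem : e ∈ Ideal.jacobson (⊥ : Ideal R)) : e = 0 := by
  obtain ⟨z, hz⟩ := Ideal.mem_jacobson_iff.1 hmem (-1)
  have hz' : z * (1 - e) = 1 := by
    rw [Ideal.mem_bot, sub_eq_zero] at hz
    refine Eq.trans ?_ hz
    noncomm_ring
  calc e = z * (1 - e) * e := by rw [hz', one_mul]
    _ = 0 := by rw [mul_assoc, sub_mul, one_mul, he.eq, sub_self, mul_zero]

/-- Given a decomposition of the unity into primitive idempotents, every nonzero idempotent
generates a two-sided ideal containing one of them. -/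
theorem exists_eq_mul_mul_of_sum_primitive_eq_one {k R ι : Type} [Field k] [Ring R] [Algebra k R]
    [FiniteDimensional k R] [Fintype ι] {p : ι → R}
    (hp : ∀ i, IsPrimitiveIdemIn Set.univ (p i)) (hsum : ∑ i, p i = 1) {e : R}
    (he : IsIdempotentElem e) (he0 : e ≠ 0) : ∃ i a b, p i = a * e * b := by
  by_contra! hcon
  refine he0 (he.eq_zero_of_mem_jacobson_bot ?_)
  have hdecomp : e = ∑ i, e * p i * e := by
    rw [← Finset.sum_mul, ← Finset.mul_sum, hsum, mul_one, he.eq]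
  rw [hdecomp]
  refine Ideal.sum_mem _ fun i _ => Ideal.mem_jacobson_bot_of_forall_isNilpotent fun y => ?_
  have hpi : p i * p i = p i := (hp i).2.1
  obtain ⟨n, hn⟩ | ⟨b, hb⟩ := (hp i).isNilpotent_or_exists_mul_eq (k := k)
    (a := p i * e * (y * e * p i)) (by simp only [← mul_assoc, hpi])
    (by simp only [mul_assoc, hpi])
  · refine ⟨n + 1, ?_⟩
    have hsemi : SemiconjBy (p i * e) (y * (e * p i * e)) (p i * e * (y * e * p i)) := by
      simp only [SemiconjBy, mul_assoc]
      rw [← mul_assoc (p i) (p i), hpi]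
    have hsemi' := (hsemi.pow_right n).eq
    rw [hn, zero_mul] at hsemi'
    calc (y * (e * p i * e)) ^ (n + 1)
        = y * e * (p i * e * (y * (e * p i * e)) ^ n) := by simp only [pow_succ', mul_assoc]
      _ = 0 := by rw [hsemi', mul_zero]
  · exact absurd (hb.symm.trans (by simp only [mul_assoc])) (hcon i (b * p i) (y * e * p i))

theorem left_wellGraded_iff_primitive_idempotents
    (k : Type) [Field k] (A : Type) [Ring A] [Algebra k A] [FiniteDimensional k A]
    (𝒜 : ℕ → Submodule k A) [GradedAlgebra 𝒜]
    (c : ℕ) (hc : 1 ≤ c) (hcne : 𝒜 c ≠ ⊥) (htop : ∀ n : ℕ, c < n → 𝒜 n = ⊥)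
    (l : ℕ) (e : Fin l → A)
    (hprim : ∀ i, IsPrimitiveIdemIn (𝒜 0 : Set A) (e i))
    (horth : ∀ i j, i ≠ j → e i * e j = 0)
    (hsum : ∑ i, e i = 1) :
    LeftWellGraded 𝒜 c ↔ ∀ i, ∃ x ∈ 𝒜 c, e i * x ≠ 0 := by
  constructor
  · intro h i
    exact h (e i) (hprim i).1 (hprim i).2.1 (hprim i).2.2.1
  · intro h f hf hfi hf0
    let S := SetLike.GradeZero.subalgebra 𝒜
    have hp : ∀ i, IsPrimitiveIdemIn (Set.univ : Set S) ⟨e i, (hprim i).1⟩ := by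
      intro i
      obtain ⟨-, hi, hi0, hi'⟩ := hprim i
      refine ⟨trivial, Subtype.ext hi, fun h0 => hi0 (congrArg Subtype.val h0), ?_⟩
      intro a b _ _ ha hb ha0 hb0 hab hba heq
      exact hi' a b a.2 b.2 (congrArg Subtype.val ha) (congrArg Subtype.val hb)
        (fun h0 => ha0 (Subtype.ext h0)) (fun h0 => hb0 (Subtype.ext h0))
        (congrArg Subtype.val hab) (congrArg Subtype.val hba) (congrArg Subtype.val heq)
    obtain ⟨i, a, b, hab⟩ := exists_eq_mul_mul_of_sum_primitive_eq_one (k := k) hp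
      (Subtype.ext (by simpa using hsum)) (e := ⟨f, hf⟩) (Subtype.ext hfi)
      (fun h0 => hf0 (congrArg Subtype.val h0))
    have hab' : e i = a * f * b := congrArg Subtype.val hab
    obtain ⟨x, hx, hex⟩ := h i
    refine ⟨b * x, ?_, fun h0 => hex ?_⟩
    · simpa using SetLike.mul_mem_graded (A := 𝒜) b.2 hx
    · rw [hab', mul_assoc, mul_assoc, h0, mul_zero]
end

section
/- Let B be a basic finite-dimensional k-algebra, X a nonzero finite-dimensional B-bimodule on which k acts centrally, and suppose T = B ⋉ X is well-graded and self-injective (injective as a left module over itself). Let 1 = e_1 + … + e_l be a decomposition of the unity of B into pairwise orthogonal primitive idempotents. Then there is a permutation s of {1,…,l} such that for each i there is an isomorphism of graded left T-modules Te_i ≅ D(e_{s(i)}T)(−1). -/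
/-!
STATEMENT 13: Let `B` be a basic finite-dimensional `k`-algebra, `X` a nonzero
finite-dimensional `B`-bimodule on which `k` acts centrally, and suppose `T = B ⋉ X`
is well-graded and self-injective.  Let `1 = e_1 + ⋯ + e_l` be a decomposition of the
unity of `B` into pairwise orthogonal primitive idempotents.  Then there is a
permutation `s` of `{1,…,l}` such that `Te_i ≅ D(e_{s(i)}T)(−1)` as graded left
`T`-modules.

`D(e_jT)` is the `k`-linear dual of the right ideal `e_jT`, a left `T`-module via
`(t • f) x = f (x * t)`.  A `T`-linear isomorphism `φ : Te_i ≃ D(e_{s(i)}T)` is graded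
of degree `(−1)`, i.e. an isomorphism `Te_i ≅ D(e_{s(i)}T)(−1)` of graded modules,
precisely when it pairs the degree-`0` part `Be_i` trivially with the degree-`0` part
`e_{s(i)}B` and the degree-`1` part `Xe_i` trivially with the degree-`1` part
`e_{s(i)}X`.
-/

open CategoryTheory MulOpposite
set_option synthInstance.maxHeartbeats 1000000
set_option maxHeartbeats 1000000
set_option linter.unusedVariables false

section DualRight
variable (k : Type) [Field k] (T : Type) [Ring T] [Algebra k T]

/-- Right multiplication by `t` on a right ideal `N ≤ T`, as a `k`-linear map. -/
def rmulMap (N : Submodule Tᵐᵒᵖ T) (t : T) : ↥N →ₗ[k] ↥N where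
  toFun x := ⟨x.1 * t, by
    have := N.smul_mem (op t) x.2
    rwa [MulOpposite.smul_eq_mul_unop, unop_op] at this⟩
  map_add' x y := Subtype.ext (add_mul _ _ _)
  map_smul' r x := Subtype.ext (smul_mul_assoc r x.1 t)

/-- The left `T`-module structure on the dual `D(N)` of a right ideal `N ≤ T`:
`(t • f) x = f (x * t)`. -/
noncomputable instance dualOfRightIdeal (N : Submodule Tᵐᵒᵖ T) :
    Module T (Module.Dual k ↥N) where
  smul t f := f.comp (rmulMap k T N t)
  one_smul f := LinearMap.ext fun x => congrArg f (Subtype.ext (mul_one x.1))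
  mul_smul t t' f := LinearMap.ext fun x =>
    congrArg f (Subtype.ext (mul_assoc x.1 t t').symm)
  smul_zero t := rfl
  smul_add t f g := rfl
  add_smul t t' f := LinearMap.ext fun x => by
    have h : rmulMap k T N (t + t') x = rmulMap k T N t x + rmulMap k T N t' x :=
      Subtype.ext (mul_add x.1 t t')
    show f (rmulMap k T N (t + t') x) = f (rmulMap k T N t x) + f (rmulMap k T N t' x)
    rw [h, map_add]
  zero_smul f := LinearMap.ext fun x => by
    have h : rmulMap k T N 0 x = 0 := Subtype.ext (mul_zero x.1)
    show f (rmulMap k T N 0 x) = 0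
    rw [h, map_zero]

end DualRight

/-- The right ideal `eB`. -/
def rightIdeal {B : Type} [Ring B] (e : B) : Submodule Bᵐᵒᵖ B :=
  LinearMap.range (LinearMap.toSpanSingleton Bᵐᵒᵖ B e)

theorem mem_leftIdeal_iff {T : Type} [Ring T] {e x : T} (he : IsIdempotentElem e) :
    x ∈ leftIdeal e ↔ x * e = x := by
  constructor
  · rintro ⟨t, rfl⟩
    simp [mul_assoc, he.eq]
  · intro h
    exact ⟨x, by simpa using h⟩

theorem mem_rightIdeal_iff {T : Type} [Ring T] {e y : T} (he : IsIdempotentElem e) :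
    y ∈ rightIdeal e ↔ e * y = y := by
  constructor
  · rintro ⟨t, rfl⟩
    simp [← mul_assoc, he.eq]
  · intro h
    exact ⟨op y, by simpa using h⟩

/-- If `e` is primitive, an idempotent of the corner ring `eTe` is `0` or `e`. -/
theorem IsPrimitiveIdem.eq_zero_or_eq {T : Type} [Ring T] {e f : T} (he : IsPrimitiveIdem e)
    (hf : IsIdempotentElem f) (hef : e * f = f) (hfe : f * e = f) : f = 0 ∨ f = e := by
  by_contra! h
  refine he.2.2 f (e - f) hf ?_ h.1 (sub_ne_zero.2 h.2.symm) ?_ ?_ (by abel)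
  · simp [IsIdempotentElem, mul_sub, sub_mul, he.1.eq, hf.eq, hef, hfe]
  · simp [mul_sub, hf.eq, hfe]
  · simp [sub_mul, hf.eq, hef]

/-- The left ideal generated by a primitive idempotent is indecomposable. -/
theorem IsPrimitiveIdem.eq_bot_or_eq_bot_of_isCompl {T : Type} [Ring T] {e : T}
    (he : IsPrimitiveIdem e) {P Q : Submodule T (leftIdeal e)} (h : IsCompl P Q) :
    P = ⊥ ∨ Q = ⊥ := by
  have hgen : ∀ x : leftIdeal e, x = x.1 • (⟨e, (mem_leftIdeal_iff he.1).2 he.1⟩ : leftIdeal e) :=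
    fun x => Subtype.ext ((mem_leftIdeal_iff he.1).1 x.2).symm
  obtain ⟨p, hp, q, hq, hpq⟩ := Submodule.mem_sup.1
    (h.sup_eq_top ▸ Submodule.mem_top :
      (⟨e, (mem_leftIdeal_iff he.1).2 he.1⟩ : leftIdeal e) ∈ P ⊔ Q)
  have hpe := (mem_leftIdeal_iff he.1).1 p.2
  have hpq' : p.1 + q.1 = e := congrArg Subtype.val hpq
  have hzero : p.1 • q = 0 := by
    have hmem : p.1 • q ∈ P := by
      have : p.1 • q = p - p.1 • p := by
        apply Subtype.ext
        change p.1 * q.1 = p.1 - p.1 * p.1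
        rw [eq_sub_iff_add_eq, ← mul_add, add_comm, hpq', hpe]
      rw [this]
      exact P.sub_mem hp (P.smul_mem _ hp)
    exact (Submodule.mem_bot T).1 (h.inf_eq_bot ▸ ⟨hmem, Q.smul_mem _ hq⟩)
  have hpq0 : p.1 * q.1 = 0 := congrArg Subtype.val hzero
  have hpp : p.1 * p.1 = p.1 := by
    have := congrArg (p.1 * ·) hpq'
    simpa [mul_add, hpq0, hpe] using this
  have hqz : q.1 * p.1 = 0 := by
    have hmem : q.1 • p ∈ Q := by
      have : q.1 • p = q - q.1 • q := by
        apply Subtype.ext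
        change q.1 * p.1 = q.1 - q.1 * q.1
        rw [eq_sub_iff_add_eq, ← mul_add, hpq', (mem_leftIdeal_iff he.1).1 q.2]
      rw [this]
      exact Q.sub_mem hq (Q.smul_mem _ hq)
    exact congrArg Subtype.val
      ((Submodule.mem_bot T).1 (h.inf_eq_bot ▸ ⟨P.smul_mem _ hp, hmem⟩) : q.1 • p = 0)
  have hep : e * p.1 = p.1 := by
    simpa [add_mul, hqz, hpp] using (congrArg (· * p.1) hpq').symm
  rcases he.eq_zero_or_eq hpp hep hpe with h0 | h1
  · left
    have hqe : (⟨e, (mem_leftIdeal_iff he.1).2 he.1⟩ : leftIdeal e) ∈ Q := by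
      rwa [← hpq, show p = 0 from Subtype.ext h0, zero_add]
    have hQ : Q = ⊤ := eq_top_iff.2 fun x _ => by rw [hgen x]; exact Q.smul_mem _ hqe
    simpa [hQ] using h.inf_eq_bot
  · right
    have hpe : (⟨e, (mem_leftIdeal_iff he.1).2 he.1⟩ : leftIdeal e) ∈ P := by
      rwa [← show p = ⟨e, _⟩ from Subtype.ext h1]
    have hP : P = ⊤ := eq_top_iff.2 fun x _ => by rw [hgen x]; exact P.smul_mem _ hpe
    simpa [hP] using h.inf_eq_bot

theorem leftIdeal_injective {T : Type} [Ring T] (hT : Module.Injective T T) {e : T}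
    (he : IsIdempotentElem e) : Module.Injective T (leftIdeal e) where
  out _ _ _ _ _ _ f hf g := by
    obtain ⟨h, hh⟩ := hT.out f hf ((leftIdeal e).subtype ∘ₗ g)
    refine ⟨(LinearMap.toSpanSingleton T T e).rangeRestrict ∘ₗ h, fun x => Subtype.ext ?_⟩
    change h (f x) * e = (g x).1
    rw [hh]
    exact (mem_leftIdeal_iff he).1 (g x).2

/-- An injective indecomposable module of finite length is uniform. -/
theorem eq_bot_or_eq_bot_of_disjoint {T M : Type} [Ring T] [AddCommGroup M] [Module T M]
    [IsNoetherian T M] [IsArtinian T M] (hM : Module.Injective T M)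
    (hind : ∀ P Q : Submodule T M, IsCompl P Q → P = ⊥ ∨ Q = ⊥)
    {K L : Submodule T M} (hKL : Disjoint K L) : K = ⊥ ∨ L = ⊥ := by
  have hcop : Function.Injective (K.subtype.coprod L.subtype) := by
    rw [← LinearMap.ker_eq_bot, LinearMap.ker_coprod_of_disjoint_range]
    · simp
    · simpa using hKL
  obtain ⟨h, hh⟩ := hM.out (K.subtype.coprod L.subtype) hcop (K.subtype ∘ₗ LinearMap.fst T K L)
  have hK : ∀ x ∈ K, h x = x := fun x hx => by simpa using hh (⟨x, hx⟩, 0)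
  have hL : ∀ x ∈ L, h x = 0 := fun x hx => by simpa using hh (0, ⟨x, hx⟩)
  obtain ⟨n, hn, hc⟩ := ((Filter.eventually_ge_atTop 1).and
    h.eventually_isCompl_ker_pow_range_pow).exists
  rcases hind _ _ hc with h0 | h0
  · right
    rw [eq_bot_iff, ← h0]
    intro x hx
    obtain ⟨m, rfl⟩ := Nat.exists_eq_add_of_le' hn
    rw [LinearMap.mem_ker, pow_succ, Module.End.mul_apply, hL x hx, map_zero]
  · left
    rw [eq_bot_iff, ← h0]
    intro x hx
    refine ⟨x, ?_⟩
    clear hn hc h0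
    induction n with
    | zero => simp
    | succ m ih => rw [pow_succ, Module.End.mul_apply, hK x hx, ih]

/-- The `T`-linear map `Te → D(fT)` attached to a linear functional `c` on `T`,
given by `x ↦ (y ↦ c (y * x))`. -/
def pairingMap {k T : Type} [Field k] [Ring T] [Algebra k T] (c : T →ₗ[k] k) (e f : T) :
    leftIdeal e →ₗ[T] Module.Dual k (rightIdeal f) where
  toFun x :=
    { toFun := fun y => c (y.1 * x.1)
      map_add' := fun y z => by simp [add_mul]
      map_smul' := fun r y => by
        change c ((r • y.1) * x.1) = r • c (y.1 * x.1)
        rw [smul_mul_assoc, map_smul] }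
  map_add' x z := LinearMap.ext fun y => by
    change c (y.1 * (x.1 + z.1)) = c (y.1 * x.1) + c (y.1 * z.1)
    rw [mul_add, map_add]
  map_smul' t x := LinearMap.ext fun y => congrArg c (mul_assoc y.1 t x.1).symm

/-- Idempotent endomorphisms of `D(fT)` are trivial when `f` is primitive. -/
theorem IsPrimitiveIdem.dual_endomorphism_eq {k T : Type} [Field k] [Ring T] [Algebra k T]
    [FiniteDimensional k T] {f : T} (hf : IsPrimitiveIdem f)
    (p : Module.Dual k (rightIdeal f) →ₗ[T] Module.Dual k (rightIdeal f))
    (hp : ∀ g, p (p g) = p g) : (∀ g, p g = 0) ∨ ∀ g, p g = g := by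
  have hfin : FiniteDimensional k (rightIdeal f) :=
    Module.Finite.of_injective ((rightIdeal f).subtype.restrictScalars k) Subtype.val_injective
  have hsmul : ∀ (r : k) (g : Module.Dual k (rightIdeal f)), r • g = (algebraMap k T r) • g :=
    fun r g => LinearMap.ext fun y => by
      change r • g y = g (rmulMap k T _ (algebraMap k T r) y)
      rw [← map_smul]
      congr 1
      apply Subtype.ext
      change r • y.1 = y.1 * algebraMap k T r
      rw [Algebra.smul_def, Algebra.commutes]
  let pk : Module.Dual k (rightIdeal f) →ₗ[k] Module.Dual k (rightIdeal f) :=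
    { toFun := p
      map_add' := map_add p
      map_smul' := fun r g => by rw [hsmul, map_smul, RingHom.id_apply, hsmul] }
  let q : rightIdeal f → rightIdeal f := fun y =>
    (Module.evalEquiv k (rightIdeal f)).symm (pk.dualMap (Module.evalEquiv k (rightIdeal f) y))
  have hq : ∀ (g : Module.Dual k (rightIdeal f)) y, g (q y) = p g y := fun g y => by
    simp [q, pk]
  have hext : ∀ y z : rightIdeal f, (∀ g : Module.Dual k (rightIdeal f), g y = g z) → y = z :=
    fun y z h => (Module.evalEquiv k (rightIdeal f)).injective (LinearMap.ext h)
  have hqmul : ∀ y t, q (rmulMap k T _ t y) = rmulMap k T _ t (q y) := fun y t =>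
    hext _ _ fun g => by
      rw [hq]
      change (t • p g) y = (t • g) (q y)
      rw [hq, map_smul]
  have hqq : ∀ y, q (q y) = q y := fun y => hext _ _ fun g => by rw [hq, hq, hp, hq]
  let u : rightIdeal f := ⟨f, (mem_rightIdeal_iff hf.1).2 hf.1⟩
  have hu : ∀ y : rightIdeal f, y = rmulMap k T _ y.1 u := fun y =>
    Subtype.ext ((mem_rightIdeal_iff hf.1).1 y.2).symm
  have hqu : ∀ y : rightIdeal f, (q y).1 = (q u).1 * y.1 := fun y => by
    conv_lhs => rw [hu y, hqmul]
    rfl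
  have hidem : IsIdempotentElem (q u).1 := by
    rw [IsIdempotentElem, ← hqu, hqq]
  rcases hf.eq_zero_or_eq hidem ((mem_rightIdeal_iff hf.1).1 (q u).2) (hqu u).symm with h | h
  · left
    refine fun g => LinearMap.ext fun y => ?_
    rw [← hq, show q y = 0 from Subtype.ext (by rw [hqu, h, zero_mul]; rfl), map_zero]
    rfl
  · right
    refine fun g => LinearMap.ext fun y => ?_
    rw [← hq, show q y = y from Subtype.ext (by rw [hqu, h, (mem_rightIdeal_iff hf.1).1 y.2])]

/-- A nonzero injective homomorphism from an injective module to `D(fT)`, with `f` primitive,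
is bijective. -/
theorem IsPrimitiveIdem.bijective_of_injective {k T M : Type} [Field k] [Ring T] [Algebra k T]
    [FiniteDimensional k T] [AddCommGroup M] [Module T M] (hM : Module.Injective T M)
    {f : T} (hf : IsPrimitiveIdem f) (φ : M →ₗ[T] Module.Dual k (rightIdeal f))
    (hφ : Function.Injective φ) (hne : φ ≠ 0) : Function.Bijective φ := by
  obtain ⟨r, hr⟩ := hM.out φ hφ LinearMap.id
  refine ⟨hφ, ?_⟩
  rcases hf.dual_endomorphism_eq (φ ∘ₗ r) (fun g => by simp [hr]) with h | h
  · exact absurd (LinearMap.ext fun x => by simpa [hr] using h (φ x)) hne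
  · exact fun g => ⟨r g, h g⟩

theorem IsPrimitiveIdem.inl {B X : Type} [Ring B] [AddCommGroup X] [Module B X] [Module Bᵐᵒᵖ X]
    [SMulCommClass B Bᵐᵒᵖ X] {e : B} (he : IsPrimitiveIdem e) :
    IsPrimitiveIdem (TrivSqZeroExt.inl e : TrivSqZeroExt B X) := by
  have hnil : ∀ f : TrivSqZeroExt B X, IsIdempotentElem f → f.fst = 0 → f = 0 := by
    intro f hf h
    rw [← hf.eq]
    ext <;> simp [h]
  have hfst : ∀ f : TrivSqZeroExt B X, IsIdempotentElem f → IsIdempotentElem f.fst :=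
    fun f hf => by rw [IsIdempotentElem, ← TrivSqZeroExt.fst_mul, hf.eq]
  refine ⟨?_, fun h => he.2.1 (by simpa using congrArg TrivSqZeroExt.fst h), ?_⟩
  · rw [IsIdempotentElem, TrivSqZeroExt.inl_mul_inl, he.1.eq]
  · intro f g hf hg hf0 hg0 hfg hgf h
    refine he.2.2 f.fst g.fst (hfst f hf) (hfst g hg) (fun h => hf0 (hnil f hf h))
      (fun h => hg0 (hnil g hg h)) ?_ ?_ ?_
    · rw [← TrivSqZeroExt.fst_mul, hfg, TrivSqZeroExt.fst_zero]
    · rw [← TrivSqZeroExt.fst_mul, hgf, TrivSqZeroExt.fst_zero]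
    · simpa using congrArg TrivSqZeroExt.fst h

/-- Isomorphisms `Te ≅ Te'` are given by elements `a ∈ eTe'` and `b ∈ e'Te` inverse to
each other. -/
theorem nonempty_leftIdeal_equiv_iff {T : Type} [Ring T] {e e' : T} (he : IsIdempotentElem e)
    (he' : IsIdempotentElem e') :
    Nonempty (leftIdeal e ≃ₗ[T] leftIdeal e') ↔
      ∃ a b : T, a * e' = a ∧ b * e = b ∧ a * b = e ∧ b * a = e' := by
  constructor
  · rintro ⟨ψ⟩
    have key : ∀ {e e' : T} (he : IsIdempotentElem e) (ψ : leftIdeal e →ₗ[T] leftIdeal e')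
        (x : leftIdeal e), (ψ x).1 = x.1 * (ψ ⟨e, (mem_leftIdeal_iff he).2 he⟩).1 := by
      intro e e' he ψ x
      conv_lhs => rw [show x = x.1 • (⟨e, (mem_leftIdeal_iff he).2 he⟩ : leftIdeal e) from
        Subtype.ext ((mem_leftIdeal_iff he).1 x.2).symm, map_smul]
      rfl
    refine ⟨_, _, (mem_leftIdeal_iff he').1 (ψ ⟨e, (mem_leftIdeal_iff he).2 he⟩).2,
      (mem_leftIdeal_iff he).1 (ψ.symm ⟨e', (mem_leftIdeal_iff he').2 he'⟩).2, ?_, ?_⟩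
    · exact (key he' ψ.symm.toLinearMap _).symm.trans (by simp)
    · exact (key he ψ.toLinearMap _).symm.trans (by simp)
  · rintro ⟨a, b, ha, hb, hab, hba⟩
    have hmem : ∀ {a e' : T}, IsIdempotentElem e' → a * e' = a → ∀ x, x * a ∈ leftIdeal e' :=
      fun h h' x => (mem_leftIdeal_iff h).2 (by rw [mul_assoc, h'])
    exact ⟨{
      toFun := fun x => ⟨x.1 * a, hmem he' ha _⟩
      map_add' := fun x y => Subtype.ext (add_mul _ _ _)
      map_smul' := fun t x => Subtype.ext (mul_assoc _ _ _)
      invFun := fun x => ⟨x.1 * b, hmem he hb _⟩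
      left_inv := fun x => Subtype.ext (by
        change x.1 * a * b = x.1
        rw [mul_assoc, hab, (mem_leftIdeal_iff he).1 x.2])
      right_inv := fun x => Subtype.ext (by
        change x.1 * b * a = x.1
        rw [mul_assoc, hba, (mem_leftIdeal_iff he').1 x.2]) }⟩

theorem nonempty_leftIdeal_equiv_of_inl {B X : Type} [Ring B] [AddCommGroup X] [Module B X]
    [Module Bᵐᵒᵖ X] [SMulCommClass B Bᵐᵒᵖ X] {e e' : B} (he : IsIdempotentElem e)
    (he' : IsIdempotentElem e')
    (h : Nonempty (leftIdeal (TrivSqZeroExt.inl e : TrivSqZeroExt B X) ≃ₗ[TrivSqZeroExt B X]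
      leftIdeal (TrivSqZeroExt.inl e' : TrivSqZeroExt B X))) :
    Nonempty (leftIdeal e ≃ₗ[B] leftIdeal e') := by
  have hinl : ∀ {e : B}, IsIdempotentElem e →
      IsIdempotentElem (TrivSqZeroExt.inl e : TrivSqZeroExt B X) := fun h => by
    rw [IsIdempotentElem, TrivSqZeroExt.inl_mul_inl, h.eq]
  obtain ⟨a, b, h₁, h₂, h₃, h₄⟩ := (nonempty_leftIdeal_equiv_iff (hinl he) (hinl he')).1 h
  refine (nonempty_leftIdeal_equiv_iff he he').2 ⟨a.fst, b.fst, ?_, ?_, ?_, ?_⟩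
  · simpa using congrArg TrivSqZeroExt.fst h₁
  · simpa using congrArg TrivSqZeroExt.fst h₂
  · simpa using congrArg TrivSqZeroExt.fst h₃
  · simpa using congrArg TrivSqZeroExt.fst h₄

/-- A uniform artinian module has a nonzero submodule below every nonzero submodule. -/
theorem exists_least_nonzero_submodule {T M : Type} [Ring T] [AddCommGroup M] [Module T M]
    [IsArtinian T M] [Nontrivial M]
    (huni : ∀ K L : Submodule T M, Disjoint K L → K = ⊥ ∨ L = ⊥) :
    ∃ S : Submodule T M, S ≠ ⊥ ∧ ∀ K : Submodule T M, K ≠ ⊥ → S ≤ K := by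
  obtain ⟨S, hS, -⟩ := (eq_bot_or_exists_atom_le (⊤ : Submodule T M)).resolve_left top_ne_bot
  refine ⟨S, hS.1, fun K hK => ?_⟩
  by_contra h
  exact (huni S K (hS.not_le_iff_disjoint.1 h)).elim hS.1 hK

/-- Over a left self-injective `B ⋉ X`, if `e` is primitive and `Xe ≠ 0`, then the socle of `Te`
gives a graded isomorphism `Te ≅ D(e_jT)(-1)` for some `j`. -/
theorem exists_graded_dual_equiv
    (k : Type) [Field k] (B : Type) [Ring B] [Algebra k B] [FiniteDimensional k B]
    (X : Type) [AddCommGroup X] [Module B X] [Module Bᵐᵒᵖ X] [SMulCommClass B Bᵐᵒᵖ X]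
    [Module k X] [IsScalarTower k B X] [IsScalarTower k Bᵐᵒᵖ X] [FiniteDimensional k X]
    (hinj : Module.Injective (TrivSqZeroExt B X) (TrivSqZeroExt B X))
    {ι : Type} [Fintype ι] {e : ι → B} (hprim : ∀ i, IsPrimitiveIdem (e i))
    (hsum : ∑ i, e i = 1) (i : ι) (hXi : ∃ x : X, op (e i) • x ≠ 0) :
    ∃ j, ∃ φ : ↥(leftIdeal (TrivSqZeroExt.inl (e i) : TrivSqZeroExt B X)) ≃ₗ[TrivSqZeroExt B X]
        Module.Dual k ↥(rightIdeal (TrivSqZeroExt.inl (e j) : TrivSqZeroExt B X)),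
      ∀ (x : leftIdeal (TrivSqZeroExt.inl (e i) : TrivSqZeroExt B X))
        (y : rightIdeal (TrivSqZeroExt.inl (e j) : TrivSqZeroExt B X)),
      ((x : TrivSqZeroExt B X).snd = 0 → (y : TrivSqZeroExt B X).snd = 0 → φ x y = 0) ∧
      ((x : TrivSqZeroExt B X).fst = 0 → (y : TrivSqZeroExt B X).fst = 0 → φ x y = 0) := by
  have hfin : FiniteDimensional k (TrivSqZeroExt B X) :=
    inferInstanceAs (Module.Finite k (B × X))
  have hart : IsArtinian (TrivSqZeroExt B X) (TrivSqZeroExt B X) :=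
    isArtinian_of_tower k inferInstance
  have hnoe : IsNoetherian (TrivSqZeroExt B X) (TrivSqZeroExt B X) :=
    isNoetherian_of_tower k inferInstance
  have hpr := fun j => (hprim j).inl (X := X)
  have hMinj := leftIdeal_injective hinj (hpr i).1
  obtain ⟨x₀, hx₀⟩ := hXi
  let v : leftIdeal (TrivSqZeroExt.inl (e i) : TrivSqZeroExt B X) :=
    ⟨TrivSqZeroExt.inr (op (e i) • x₀), ⟨TrivSqZeroExt.inr x₀, TrivSqZeroExt.inr_mul_inl _ _⟩⟩
  have hv : v ≠ 0 := fun h => hx₀ (TrivSqZeroExt.inr_injective (congrArg Subtype.val h))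
  have : Nontrivial (leftIdeal (TrivSqZeroExt.inl (e i) : TrivSqZeroExt B X)) := ⟨v, 0, hv⟩
  obtain ⟨S, hS, hSle⟩ := exists_least_nonzero_submodule (T := TrivSqZeroExt B X)
    (M := leftIdeal (TrivSqZeroExt.inl (e i) : TrivSqZeroExt B X))
    fun K L hKL => eq_bot_or_eq_bot_of_disjoint hMinj
      (fun P Q => (hpr i).eq_bot_or_eq_bot_of_isCompl) hKL
  have hSfst : ∀ x ∈ S, x.1.fst = 0 := by
    intro x hx
    obtain ⟨t, rfl⟩ := Submodule.mem_span_singleton.1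
      (hSle (Submodule.span _ {v}) (by simpa using hv) hx)
    change (t * v.1).fst = 0
    simp [v]
  obtain ⟨w, hwS, hw⟩ := S.ne_bot_iff.1 hS
  obtain ⟨j, hj⟩ : ∃ j, e j • w.1.snd ≠ 0 := by
    by_contra! h
    have : w.1.snd = 0 := by
      rw [← one_smul B w.1.snd, ← hsum, Finset.sum_smul]
      exact Finset.sum_eq_zero fun j _ => h j
    exact hw (Subtype.ext (TrivSqZeroExt.ext (hSfst w hwS) this))
  obtain ⟨c, hc⟩ : ∃ c : Module.Dual k X, c (e j • w.1.snd) ≠ 0 := by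
    by_contra! h
    exact hj ((Module.forall_dual_apply_eq_zero_iff k _).1 h)
  let φ := pairingMap (c ∘ₗ (TrivSqZeroExt.sndHom B X).restrictScalars k)
    (TrivSqZeroExt.inl (e i) : TrivSqZeroExt B X)
    (TrivSqZeroExt.inl (e j) : TrivSqZeroExt B X)
  have hφw : φ w ≠ 0 := fun h => hc (by
    have := LinearMap.congr_fun h
      ⟨TrivSqZeroExt.inl (e j), (mem_rightIdeal_iff (hpr j).1).2 (hpr j).1⟩
    change c ((TrivSqZeroExt.inl (e j) * w.1 : TrivSqZeroExt B X).snd) = 0 at this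
    simpa [hSfst w hwS] using this)
  have hφinj : Function.Injective φ := by
    rw [← LinearMap.ker_eq_bot]
    by_contra h
    exact hφw (hSle _ h hwS)
  have hbij := (hpr j).bijective_of_injective hMinj φ hφinj fun h => hφw (by rw [h]; rfl)
  refine ⟨j, LinearEquiv.ofBijective φ hbij, fun x y => ⟨fun hx hy => ?_, fun hx hy => ?_⟩⟩
  all_goals
    change c ((y.1 * x.1).snd) = 0
    simp [hx, hy]

theorem projectives_are_shifted_dual_injectives
    (k : Type) [Field k] (B : Type) [Ring B] [Algebra k B] [FiniteDimensional k B]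
    (X : Type) [AddCommGroup X] [Module B X] [Module Bᵐᵒᵖ X] [SMulCommClass B Bᵐᵒᵖ X]
    [Module k X] [IsScalarTower k B X] [IsScalarTower k Bᵐᵒᵖ X] [FiniteDimensional k X]
    (hX : Nontrivial X)
    (hbasic : IsBasicAlgebra B)
    (hwg : ∀ e : B, IsIdempotentElem e → e ≠ 0 →
      (∃ x : X, e • x ≠ 0) ∧ (∃ x : X, op e • x ≠ 0))
    (hinj : Module.Injective (TrivSqZeroExt B X) (TrivSqZeroExt B X))
    (l : ℕ) (e : Fin l → B)
    (hprim : ∀ i, IsPrimitiveIdem (e i))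
    (horth : ∀ i j, i ≠ j → e i * e j = 0)
    (hsum : ∑ i, e i = 1) :
    ∃ s : Equiv.Perm (Fin l), ∀ i : Fin l,
      ∃ φ : ↥(leftIdeal (TrivSqZeroExt.inl (e i) : TrivSqZeroExt B X)) ≃ₗ[TrivSqZeroExt B X]
        Module.Dual k ↥(rightIdeal (TrivSqZeroExt.inl (e (s i)) : TrivSqZeroExt B X)),
      -- φ maps the degree-0 part `Be_i` to the degree-0 part of `D(e_{s i}T)(-1)`,
      -- i.e. to the functionals vanishing on the degree-0 part `e_{s i}B` :
      (∀ x : ↥(leftIdeal (TrivSqZeroExt.inl (e i) : TrivSqZeroExt B X)),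
        TrivSqZeroExt.snd (x : TrivSqZeroExt B X) = 0 →
        ∀ y : ↥(rightIdeal (TrivSqZeroExt.inl (e (s i)) : TrivSqZeroExt B X)),
          TrivSqZeroExt.snd (y : TrivSqZeroExt B X) = 0 → φ x y = 0) ∧
      -- and the degree-1 part `Xe_i` to the functionals vanishing on `e_{s i}X` :
      (∀ x : ↥(leftIdeal (TrivSqZeroExt.inl (e i) : TrivSqZeroExt B X)),
        TrivSqZeroExt.fst (x : TrivSqZeroExt B X) = 0 →
        ∀ y : ↥(rightIdeal (TrivSqZeroExt.inl (e (s i)) : TrivSqZeroExt B X)),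
          TrivSqZeroExt.fst (y : TrivSqZeroExt B X) = 0 → φ x y = 0) := by
  choose s φ hφ using fun i =>
    exists_graded_dual_equiv k B X hinj hprim hsum i (hwg (e i) (hprim i).1 (hprim i).2.1).2
  have hs : Function.Injective s := by
    intro i i' h
    by_contra hne
    obtain ⟨ψ⟩ : Nonempty (leftIdeal (TrivSqZeroExt.inl (e i) : TrivSqZeroExt B X)
        ≃ₗ[TrivSqZeroExt B X] leftIdeal (TrivSqZeroExt.inl (e i') : TrivSqZeroExt B X)) := by
      have ψ := φ i
      rw [h] at ψ
      exact ⟨ψ.trans (φ i').symm⟩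
    obtain ⟨χ⟩ := nonempty_leftIdeal_equiv_of_inl (hprim i).1 (hprim i').1 ⟨ψ⟩
    exact (hbasic l e hprim horth hsum i i' hne).false χ
  exact ⟨Equiv.ofBijective s (Finite.injective_iff_bijective.1 hs), fun i =>
    ⟨φ i, fun x hx y hy => (hφ i x y).1 hx hy, fun x hx y hy => (hφ i x y).2 hx hy⟩⟩
end
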